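/- arXiv:1910.01696 — 4 statements merged into one kernel-verified Lean document; each statement's English description precedes it below -/
import Mathlib

section
/- Fix n, m ∈ ℕ and identify Fin(nm) with Fin n × Fin m. Let p ∈ C_qc^s(nm,2) and define π(p)(i,j|x,y) := p(0,0|(x,i),(y,j)). Then π(p) ∈ C_qc^s(n,m) if and only if π(p) ∈ C_ns^s(n,m). -/
open scoped ComplexOrder BigOperators

/-- A quantum-commuting representation: a unital C*-algebra with a tracial state τ
and, for each experiment x : X, a projection-valued measure (E x i)_{i : Fin m}. -/
structure QCRep (X : Type) (m : ℕ) where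
  A : Type
  [ring : NormedRing A]
  [starRing : StarRing A]
  [cstar : CStarRing A]
  [alg : NormedAlgebra ℂ A]
  [complete : CompleteSpace A]
  [smod : StarModule ℂ A]
  τ : A →ₗ[ℂ] ℂ
  E : X → Fin m → A
  unit : τ 1 = 1
  pos : ∀ a : A, 0 ≤ τ (star a * a)
  tracial : ∀ a b : A, τ (a * b) = τ (b * a)
  proj_sa : ∀ x i, star (E x i) = E x i
  proj_idem : ∀ x i, E x i * E x i = E x i
  pvm : ∀ x, ∑ i, E x i = 1

attribute [instance] QCRep.ring QCRep.starRing QCRep.cstar QCRep.alg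
  QCRep.complete QCRep.smod

/-- Membership in the synchronous quantum-commuting correlation set C_qc^s:
`p x y i j` denotes p(i,j|x,y). -/
def IsQCSyncCorrelation {X : Type} (m : ℕ) (p : X → X → Fin m → Fin m → ℝ) : Prop :=
  ∃ r : QCRep X m, ∀ x y i j, (p x y i j : ℂ) = r.τ (r.E x i * r.E y j)

/-- Membership in the synchronous non-signaling correlation set C_ns^s. -/
def IsSyncNSCorrelation {X : Type} [Fintype X] (m : ℕ)
    (p : X → X → Fin m → Fin m → ℝ) : Prop :=
  (∀ x y i j, 0 ≤ p x y i j) ∧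
  (∀ x y, ∑ i, ∑ j, p x y i j = 1) ∧
  (∀ x i j, i ≠ j → p x x i j = 0) ∧
  (∀ x y y' i, ∑ j, p x y i j = ∑ j, p x y' i j) ∧
  (∀ x x' y j, ∑ i, p x y i j = ∑ i, p x' y i j)

section Helpers

open scoped InnerProductSpace

theorem qc_nonneg {X : Type} {m : ℕ} (r : QCRep X m) (x y : X) (i j : Fin m) :
    0 ≤ r.τ (r.E x i * r.E y j) := by
  have h := r.pos (r.E x i * r.E y j)
  have e : r.τ (star (r.E x i * r.E y j) * (r.E x i * r.E y j)) = r.τ (r.E x i * r.E y j) := by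
    rw [star_mul, r.proj_sa, r.proj_sa, mul_assoc, ← mul_assoc (r.E x i), r.proj_idem,
      r.tracial, mul_assoc, r.proj_idem]
  rwa [e] at h

theorem gns_key {A : Type} [CStarAlgebra A] (τ : A →ₗ[ℂ] ℂ)
    (pos : ∀ a : A, 0 ≤ τ (star a * a)) (tracial : ∀ a b : A, τ (a * b) = τ (b * a)) :
    ∃ (H : Type) (_ : NormedAddCommGroup H) (_ : InnerProductSpace ℂ H) (_ : CompleteSpace H)
      (ρ : A →⋆ₐ[ℂ] (H →L[ℂ] H)) (ξ : H), (∀ a, ⟪ξ, ρ a ξ⟫_ℂ = τ a) ∧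
      ∀ s, τ (star s * s) = 0 → ρ s = 0 := by
  let _ : PartialOrder A := CStarAlgebra.spectralOrder A
  have : StarOrderedRing A := CStarAlgebra.spectralOrderedRing A
  let f : A →ₚ[ℂ] ℂ := PositiveLinearMap.mk₀ τ (by
    intro x hx
    obtain ⟨b, rfl⟩ := CStarAlgebra.nonneg_iff_eq_star_mul_self.mp hx
    exact pos b)
  have hf : ∀ a, f a = τ a := fun a => rfl
  have hap : ∀ (a : A) (b : f.PreGNS), f.gnsStarAlgHom a (b : f.GNS) =
      (f.leftMulMapPreGNS a b : f.PreGNS) :=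
    fun a b => f.gnsNonUnitalStarAlgHom_apply_coe
  refine ⟨f.GNS, inferInstance, inferInstance, inferInstance, f.gnsStarAlgHom,
    ((f.toPreGNS 1 : f.PreGNS) : f.GNS), ?_, ?_⟩
  · intro a
    rw [hap, UniformSpace.Completion.inner_coe, PositiveLinearMap.preGNS_inner_def]
    simp [hf]
  · intro s hs
    ext c
    induction c using UniformSpace.Completion.induction_on with
    | hp => apply isClosed_eq <;> fun_prop
    | ih c =>
      rw [hap]
      obtain ⟨b, rfl⟩ := f.toPreGNS.surjective c
      have hz : ‖f.toPreGNS s‖ = 0 := by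
        rw [PositiveLinearMap.preGNS_norm_def]
        simp [hf, hs]
      have key : ⟪f.toPreGNS s, f.toPreGNS (s * b * star b)⟫_ℂ = 0 := by
        have := norm_inner_le_norm (𝕜 := ℂ) (f.toPreGNS s) (f.toPreGNS (s * b * star b))
        rw [hz, zero_mul] at this
        exact norm_le_zero_iff.mp this
      have h2 : ‖f.leftMulMapPreGNS s (f.toPreGNS b)‖ = 0 := by
        rw [PositiveLinearMap.preGNS_norm_def]
        rw [PositiveLinearMap.preGNS_inner_def] at key
        simp only [hf, PositiveLinearMap.ofPreGNS_toPreGNS] at key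
        have e : τ (star (s * b) * (s * b)) = 0 := by
          rw [← key, star_mul, mul_assoc, tracial]
          simp only [mul_assoc]
        simp [hf]
        simp at e
        simp [e]
      rw [ContinuousLinearMap.zero_apply, ← norm_eq_zero, UniformSpace.Completion.norm_coe]
      exact h2

theorem closure_induction₂_aux {α β : Type*} [TopologicalSpace β] (ρ : α → β)
    {P : β → β → Prop} (hc : IsClosed {q : β × β | P q.1 q.2}) (h : ∀ u v, P (ρ u) (ρ v)) :
    ∀ a ∈ closure (Set.range ρ), ∀ b ∈ closure (Set.range ρ), P a b := by
  intro a ha b hb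
  have h1 : Set.range ρ ×ˢ Set.range ρ ⊆ {q : β × β | P q.1 q.2} := by
    rintro ⟨_, _⟩ ⟨⟨u, rfl⟩, ⟨v, rfl⟩⟩
    exact h u v
  have h2 := closure_minimal h1 hc
  rw [closure_prod_eq] at h2
  exact h2 (Set.mk_mem_prod ha hb)

theorem qc_of_key {X : Type} {m : ℕ} {A : Type} [CStarAlgebra A] (τ : A →ₗ[ℂ] ℂ)
    (unit : τ 1 = 1)
    (pos : ∀ a : A, 0 ≤ τ (star a * a)) (tracial : ∀ a b : A, τ (a * b) = τ (b * a))
    (E : X → Fin m → A) (sa : ∀ x i, star (E x i) = E x i)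
    (idem : ∀ x i, E x i * E x i = E x i)
    (hS : ∀ x, τ (star (1 - ∑ i, E x i) * (1 - ∑ i, E x i)) = 0) :
    ∃ r : QCRep X m, ∀ x y i j, r.τ (r.E x i * r.E y j) = τ (E x i * E y j) := by
  obtain ⟨H, _, _, _, ρ, ξ, h1, h2⟩ := gns_key τ pos tracial
  let S : StarSubalgebra ℂ (H →L[ℂ] H) := ρ.range.topologicalClosure
  have hmem : ∀ a, ρ a ∈ S := fun a =>
    StarSubalgebra.le_topologicalClosure _ ⟨a, rfl⟩
  have : CompleteSpace S := inferInstanceAs (CompleteSpace ρ.range.topologicalClosure)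
  let φ : S →ₗ[ℂ] ℂ :=
    { toFun := fun T => ⟪ξ, (T : H →L[ℂ] H) ξ⟫_ℂ
      map_add' := by intro a b; simp [inner_add_right]
      map_smul' := by intro c a; simp [inner_smul_right] }
  have hφ : ∀ T : S, φ T = ⟪ξ, (T : H →L[ℂ] H) ξ⟫_ℂ := fun _ => rfl
  have hcl : ∀ T : S, (T : H →L[ℂ] H) ∈ closure (Set.range ρ) := fun T => by
    have := T.2
    have h3 := StarSubalgebra.topologicalClosure_coe ρ.range
    have h4 : ((ρ.range : StarSubalgebra ℂ (H →L[ℂ] H)) : Set (H →L[ℂ] H)) = Set.range ρ := by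
      ext z
      rfl
    rw [← h4, ← h3]
    exact this
  have htr : ∀ a ∈ closure (Set.range ρ), ∀ b ∈ closure (Set.range ρ),
      ⟪ξ, (a * b) ξ⟫_ℂ = ⟪ξ, (b * a) ξ⟫_ℂ := by
    intro a ha b hb
    refine closure_induction₂_aux ρ (P := fun a b => ⟪ξ, (a * b) ξ⟫_ℂ = ⟪ξ, (b * a) ξ⟫_ℂ)
      ?_ ?_ a ha b hb
    · exact isClosed_eq (by fun_prop) (by fun_prop)
    · intro u v
      rw [← map_mul, ← map_mul, h1, h1, tracial]
  refine ⟨{ A := S, τ := φ, E := fun x i => ⟨ρ (E x i), hmem _⟩, unit := ?_, pos := ?_,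
            tracial := ?_, proj_sa := ?_, proj_idem := ?_, pvm := ?_ }, ?_⟩
  · have := h1 1
    rw [map_one, unit] at this
    simpa [hφ] using this
  · intro a
    rw [hφ]
    have : ⟪ξ, ((star a * a : S) : H →L[ℂ] H) ξ⟫_ℂ =
        ⟪(a : H →L[ℂ] H) ξ, (a : H →L[ℂ] H) ξ⟫_ℂ := by
      simp [ContinuousLinearMap.star_eq_adjoint, ContinuousLinearMap.adjoint_inner_right]
    rw [this, inner_self_eq_norm_sq_to_K]
    norm_cast
    positivity
  · intro a b
    exact htr _ (hcl a) _ (hcl b)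
  · intro x i
    apply Subtype.ext
    change star (ρ (E x i)) = ρ (E x i)
    rw [← map_star, sa]
  · intro x i
    apply Subtype.ext
    change ρ (E x i) * ρ (E x i) = ρ (E x i)
    rw [← map_mul, idem]
  · intro x
    apply Subtype.ext
    have := h2 _ (hS x)
    rw [map_sub, map_one, map_sum, sub_eq_zero] at this
    simp [← this]
  · intro x y i j
    change ⟪ξ, (ρ (E x i) * ρ (E y j)) ξ⟫_ℂ = _
    rw [← map_mul, h1]

end Helpers

/-- identifying Fin (nm) with Fin n × Fin m, for p ∈ C_qc^s(nm,2) and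
π(p)(i,j|x,y) := p(0,0|(x,i),(y,j)), we have π(p) ∈ C_qc^s(n,m) ↔ π(p) ∈ C_ns^s(n,m). -/
theorem stmt7 (n m : ℕ)
    (p : (Fin n × Fin m) → (Fin n × Fin m) → Fin 2 → Fin 2 → ℝ)
    (hp : IsQCSyncCorrelation 2 p) :
    IsQCSyncCorrelation m (fun x y i j => p (x, i) (y, j) 0 0) ↔
      IsSyncNSCorrelation m (fun x y i j => p (x, i) (y, j) 0 0) := by
  constructor
  · rintro ⟨r, hr⟩
    have hs1 : ∀ x y i, ∑ j, r.τ (r.E x i * r.E y j) = r.τ (r.E x i) := by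
      intro x y i
      rw [← map_sum, ← Finset.mul_sum, r.pvm, mul_one]
    have hs2 : ∀ x y j, ∑ i, r.τ (r.E x i * r.E y j) = r.τ (r.E y j) := by
      intro x y j
      rw [← map_sum, ← Finset.sum_mul, r.pvm, one_mul]
    refine ⟨?_, ?_, ?_, ?_, ?_⟩
    · intro x y i j
      have := qc_nonneg r x y i j
      rw [← hr] at this
      exact_mod_cast this
    · intro x y
      have : ∑ i, ∑ j, r.τ (r.E x i * r.E y j) = 1 := by
        simp only [hs1]
        rw [← map_sum, r.pvm, r.unit]
      simp only [← hr] at this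
      exact_mod_cast this
    · intro x i j hij
      have h := hs1 x x i
      rw [← Finset.add_sum_erase _ _ (Finset.mem_univ i), r.proj_idem, add_eq_left] at h
      have h2 := (Finset.sum_eq_zero_iff_of_nonneg (fun k _ => qc_nonneg r x x i k)).mp h j
        (Finset.mem_erase.mpr ⟨hij.symm, Finset.mem_univ _⟩)
      rw [← hr] at h2
      exact_mod_cast h2
    · intro x y y' i
      have := (hs1 x y i).trans (hs1 x y' i).symm
      simp only [← hr] at this
      exact_mod_cast this
    · intro x x' y j
      have := (hs2 x y j).trans (hs2 x' y j).symm
      simp only [← hr] at this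
      exact_mod_cast this
  · rintro ⟨-, hsum, hsync, -, -⟩
    obtain ⟨r, hr⟩ := hp
    let _ : CStarAlgebra r.A := { }
    have hS : ∀ x : Fin n, r.τ (star (1 - ∑ i, r.E (x, i) 0) * (1 - ∑ i, r.E (x, i) 0)) = 0 := by
      intro x
      have h1 : ∑ i, ∑ j, r.τ (r.E (x, i) 0 * r.E (x, j) 0) = 1 := by
        simp only [← hr]
        exact_mod_cast hsum x x
      have h2 : ∑ i, r.τ (r.E (x, i) 0) = 1 := by
        rw [← h1]
        refine Finset.sum_congr rfl fun i _ => ?_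
        rw [Finset.sum_eq_single i, r.proj_idem]
        · intro j _ hj
          rw [← hr]
          exact_mod_cast hsync x i j hj.symm
        · simp
      have hst : star (1 - ∑ i, r.E (x, i) 0) = 1 - ∑ i, r.E (x, i) 0 := by
        simp [star_sum, r.proj_sa]
      have h3 : r.τ ((∑ i, r.E (x, i) 0) * ∑ i, r.E (x, i) 0) = 1 := by
        rw [Finset.sum_mul_sum, map_sum, ← h1]
        simp only [map_sum]
      have h4 : r.τ (∑ i, r.E (x, i) 0) = 1 := by rw [map_sum, h2]
      rw [hst, sub_mul, one_mul, mul_sub, mul_one, map_sub, map_sub, map_sub, h3, h4, r.unit]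
      simp
    obtain ⟨r', hr'⟩ := qc_of_key (X := Fin n) (m := m) r.τ r.unit r.pos r.tracial
      (fun x i => r.E (x, i) 0) (fun x i => r.proj_sa _ _) (fun x i => r.proj_idem _ _) hS
    exact ⟨r', fun x y i j => by rw [hr', ← hr]⟩
end

section
/- Fix n, m ∈ ℕ. If C_qa^s(n,m) ≠ C_qc^s(n,m), then C_qa^s(nm,2) ≠ C_qc^s(nm,2). (Hence a separation between the quantum-approximate and quantum-commuting synchronous correlation sets for some number of outcomes m yields one already in the two-outcome setting.) -/
open scoped ComplexOrder BigOperators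

/-- A quantum representation: as above, but the C*-algebra is finite-dimensional. -/
structure QRep (X : Type) (m : ℕ) extends QCRep X m where
  [fd : FiniteDimensional ℂ toQCRep.A]

/-- The synchronous quantum-commuting correlation set C_qc^s. -/
def CqcsSet (X : Type) (m : ℕ) : Set (X → X → Fin m → Fin m → ℝ) :=
  {p | ∃ r : QCRep X m, ∀ x y i j, (p x y i j : ℂ) = r.τ (r.E x i * r.E y j)}

/-- The synchronous quantum correlation set C_q^s. -/
def CqsSet (X : Type) (m : ℕ) : Set (X → X → Fin m → Fin m → ℝ) :=
  {p | ∃ r : QRep X m, ∀ x y i j, (p x y i j : ℂ) = r.τ (r.E x i * r.E y j)}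

/-- The synchronous quantum-approximate correlation set C_qa^s: the closure of C_q^s. -/
def CqasSet (X : Type) (m : ℕ) : Set (X → X → Fin m → Fin m → ℝ) :=
  closure (CqsSet X m)

section N2

variable {A : Type} [CStarAlgebra A]

/-- The tracial 2-seminorm. -/
noncomputable def ntwo (τ : A →ₗ[ℂ] ℂ) (a : A) : ℝ := Real.sqrt (τ (star a * a)).re

theorem exists_posMap (τ : A →ₗ[ℂ] ℂ) (pos : ∀ a : A, 0 ≤ τ (star a * a)) :
    ∃ (_ : PartialOrder A) (_ : StarOrderedRing A) (f : A →ₚ[ℂ] ℂ), ∀ a, f a = τ a := by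
  let _ := CStarAlgebra.spectralOrder A
  have := CStarAlgebra.spectralOrderedRing A
  refine ⟨inferInstance, inferInstance, PositiveLinearMap.mk₀ τ ?_, fun a => rfl⟩
  intro x hx
  obtain ⟨y, rfl⟩ := CStarAlgebra.nonneg_iff_eq_star_mul_self.mp hx
  exact pos y

variable (τ : A →ₗ[ℂ] ℂ)

theorem ntwo_nonneg (a : A) : 0 ≤ ntwo τ a := Real.sqrt_nonneg _

theorem ntwo_neg (a : A) : ntwo τ (-a) = ntwo τ a := by simp [ntwo]

theorem ntwo_zero : ntwo τ 0 = 0 := by simp [ntwo]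

theorem tau_ofReal {z : ℂ} (h : 0 ≤ z) : ((z.re : ℝ) : ℂ) = z := by
  rw [Complex.le_def] at h
  apply Complex.ext <;> simp [← h.2]

theorem tau_star (pos : ∀ a : A, 0 ≤ τ (star a * a))
    (a : A) : τ (star a) = star (τ a) := by
  obtain ⟨_, _, f, hf⟩ := exists_posMap τ pos
  simp only [← hf]
  exact map_star f a

theorem ntwo_sq (pos : ∀ a : A, 0 ≤ τ (star a * a))
    (a : A) : ntwo τ a ^ 2 = (τ (star a * a)).re :=
  Real.sq_sqrt (pos a).1

theorem ntwo_add (pos : ∀ a : A, 0 ≤ τ (star a * a))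
    (a b : A) : ntwo τ (a + b) ≤ ntwo τ a + ntwo τ b := by
  obtain ⟨_, _, f, hf⟩ := exists_posMap τ pos
  have key : ∀ a, ntwo τ a = ‖f.toPreGNS a‖ := fun a => by
    rw [PositiveLinearMap.preGNS_norm_def, ntwo, hf]; simp
  simp only [key, map_add]
  exact norm_add_le _ _

theorem tau_mul_le (pos : ∀ a : A, 0 ≤ τ (star a * a))
    (a b : A) : ‖τ (a * b)‖ ≤ ntwo τ (star a) * ntwo τ b := by
  obtain ⟨_, _, f, hf⟩ := exists_posMap τ pos
  have key : ∀ a, ntwo τ a = ‖f.toPreGNS a‖ := fun a => by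
    rw [PositiveLinearMap.preGNS_norm_def, ntwo, hf]; simp
  simp only [key]
  have := norm_inner_le_norm (𝕜 := ℂ) (f.toPreGNS (star a)) (f.toPreGNS b)
  rw [PositiveLinearMap.preGNS_inner_def] at this
  simpa [hf] using this

theorem ntwo_sub (pos : ∀ a : A, 0 ≤ τ (star a * a))
    (a b : A) : ntwo τ (a - b) ≤ ntwo τ a + ntwo τ b := by
  rw [sub_eq_add_neg, ← ntwo_neg τ b]; exact ntwo_add τ pos _ _

theorem ntwo_sum (pos : ∀ a : A, 0 ≤ τ (star a * a))
    {ι : Type*} (s : Finset ι) (a : ι → A) :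
    ntwo τ (∑ i ∈ s, a i) ≤ ∑ i ∈ s, ntwo τ (a i) := by
  classical
  induction s using Finset.induction_on with
  | empty => simp [ntwo_zero]
  | insert i s hi ih =>
    rw [Finset.sum_insert hi, Finset.sum_insert hi]
    exact (ntwo_add τ pos _ _).trans (by gcongr)

theorem ntwo_proj_mul (pos : ∀ a : A, 0 ≤ τ (star a * a))
    (e a : A) (h1 : star e = e) (h2 : e * e = e) :
    ntwo τ (e * a) ≤ ntwo τ a := by
  apply Real.sqrt_le_sqrt
  have h := (pos ((1 - e) * a)).1
  have e1 : star ((1 - e) * a) * ((1 - e) * a) = star a * a - star (e * a) * (e * a) := by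
    simp only [star_mul, star_sub, star_one, h1]
    have h3 : (1 - e) * (1 - e) = 1 - e := by simp [mul_sub, sub_mul, h2]
    calc star a * (1 - e) * ((1 - e) * a) = star a * ((1 - e) * (1 - e)) * a := by noncomm_ring
      _ = star a * a - star a * (e * e) * a := by rw [h3, h2]; noncomm_ring
      _ = _ := by noncomm_ring
  rw [e1] at h
  simpa using h

theorem ntwo_star (tr : ∀ a b : A, τ (a * b) = τ (b * a))
    (a : A) : ntwo τ (star a) = ntwo τ a := by
  rw [ntwo, ntwo, star_star, tr]

theorem ntwo_mul_proj (pos : ∀ a : A, 0 ≤ τ (star a * a))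
    (tr : ∀ a b : A, τ (a * b) = τ (b * a))
    (e a : A) (h1 : star e = e) (h2 : e * e = e) :
    ntwo τ (a * e) ≤ ntwo τ a := by
  rw [← ntwo_star τ tr, star_mul, h1, ← ntwo_star τ tr a]
  exact ntwo_proj_mul τ pos _ _ h1 h2

theorem ntwo_null_mul (pos : ∀ a : A, 0 ≤ τ (star a * a))
    (tr : ∀ a b : A, τ (a * b) = τ (b * a))
    (a b : A) (h : ntwo τ a = 0) : ntwo τ (a * b) = 0 := by
  have h1 : τ (star (a * b) * (a * b)) = τ ((b * star b * star a) * a) := by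
    rw [star_mul, tr (b * star b * star a) a, ← tr (a * b)]
    simp only [mul_assoc]
  have := tau_mul_le τ pos (b * star b * star a) a
  rw [h, mul_zero] at this
  have h2 := norm_le_zero_iff.mp this
  rw [ntwo, h1, h2]; simp

/-- the orthogonalization step -/
theorem orth_step (pos : ∀ a : A, 0 ≤ τ (star a * a))
    (tr : ∀ a b : A, τ (a * b) = τ (b * a))
    [FiniteDimensional ℂ A] (Q P : A) (hQ1 : star Q = Q) (hQ2 : Q * Q = Q)
    (hP1 : star P = P) (hP2 : P * P = P) :
    ∃ R : A, star R = R ∧ R * R = R ∧ Q * R = 0 ∧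
      ntwo τ (R - P) ≤ 4 * Real.sqrt (τ (Q * P)).re := by
  set e := 1 - Q with he
  have he1 : star e = e := by simp [he, hQ1]
  have he2 : e * e = e := by simp [he, mul_sub, sub_mul, hQ2]
  have hQe : Q * e = 0 := by simp [he, mul_sub, hQ2]
  set T := e * P * e with hT
  have hTsa : IsSelfAdjoint T := by
    rw [IsSelfAdjoint, hT]; simp [he1, hP1, mul_assoc]
  have hfin : (spectrum ℝ T).Finite := by
    have : FiniteDimensional ℝ A := FiniteDimensional.complexToReal A
    have hint : IsIntegral ℝ T := Algebra.IsIntegral.isIntegral T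
    have hne := minpoly.ne_zero hint
    refine (Polynomial.finite_setOfPred_isRoot hne).subset ?_
    intro t ht
    have h1 := spectrum.subset_polynomial_aeval T (minpoly ℝ T) ⟨t, ht, rfl⟩
    rw [minpoly.aeval] at h1
    by_contra h2
    have h3 : (minpoly ℝ T).eval t ≠ 0 := h2
    rw [spectrum.mem_iff, sub_zero] at h1
    exact h1 ((IsUnit.mk0 _ h3).map (algebraMap ℝ A))
  have hc : ∀ g : ℝ → ℝ, ContinuousOn g (spectrum ℝ T) := fun g => hfin.continuousOn g
  set f : ℝ → ℝ := fun t => if 1/2 ≤ t then 1 else 0 with hf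
  set R := cfc f T with hR
  have hn : ntwo τ (Q * P) = Real.sqrt (τ (Q * P)).re := by
    rw [ntwo, star_mul, hQ1, hP1]
    congr 2
    rw [tr (P * Q), mul_assoc, ← mul_assoc P P, hP2, tr Q, mul_assoc, hQ2, tr]
  have hn' : ntwo τ (P * Q) = ntwo τ (Q * P) := by
    rw [← ntwo_star τ tr, star_mul, hQ1, hP1]
  refine ⟨R, ?_, ?_, ?_, ?_⟩
  · exact (cfc_predicate f T : IsSelfAdjoint R)
  · rw [hR, ← cfc_mul f f T (hc _) (hc _)]
    congr 1
    ext t; simp only [hf]; split_ifs <;> simp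
  · have : R = T * cfc (fun t => f t / t) T := by
      conv_rhs => enter [1]; rw [← cfc_id' ℝ T hTsa]
      rw [hR, ← cfc_mul _ _ T (hc _) (hc _)]
      congr 1
      ext t; simp only [hf]; split_ifs with h
      · field_simp
      · simp
    rw [this, hT, ← mul_assoc, ← mul_assoc, ← mul_assoc, hQe]; simp
  · have h1 : ntwo τ (R - T) ≤ 2 * ntwo τ (T - T * T) := by
      have hd : R - T = cfc (fun t => f t - t) T := by
        conv_lhs => enter [2]; rw [← cfc_id' ℝ T hTsa]
        rw [hR, ← cfc_sub _ _ T (hc _) (hc _)]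
      have hd' : T - T * T = cfc (fun t : ℝ => t - t * t) T := by
        rw [cfc_sub (fun t : ℝ => t) (fun t => t * t) T (hc _) (hc _),
          cfc_mul (fun t : ℝ => t) (fun t => t) T (hc _) (hc _), cfc_id' ℝ T hTsa]
      have hsa1 : star (R - T) = R - T := by
        rw [hd]; exact (cfc_predicate (fun t : ℝ => f t - t) T : IsSelfAdjoint _)
      have hsa2 : star (T - T * T) = T - T * T := by
        rw [hd']; exact (cfc_predicate (fun t : ℝ => t - t * t) T : IsSelfAdjoint _)
      set g : ℝ → ℝ := fun t => Real.sqrt (4 * ((t - t * t) * (t - t * t)) - (f t - t) * (f t - t))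
      have hg : ∀ t, g t * g t =
          4 * ((t - t * t) * (t - t * t)) - (f t - t) * (f t - t) := by
        intro t
        apply Real.mul_self_sqrt
        simp only [hf]; split_ifs with h
        · have : 4 * ((t - t * t) * (t - t * t)) - (1 - t) * (1 - t)
            = (1 - t)^2 * ((2 * t - 1) * (2 * t + 1)) := by ring
          rw [this]
          have : 0 ≤ 2 * t - 1 := by linarith
          have : 0 ≤ 2 * t + 1 := by linarith
          positivity
        · have : 4 * ((t - t * t) * (t - t * t)) - (0 - t) * (0 - t)
            = t ^ 2 * ((1 - 2 * t) * (3 - 2 * t)) := by ring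
          rw [this]
          have : 0 ≤ 1 - 2 * t := by linarith
          have : 0 ≤ 3 - 2 * t := by linarith
          positivity
      have hgg : star (cfc g T) * cfc g T =
          (4 : ℝ) • (star (T - T * T) * (T - T * T)) - star (R - T) * (R - T) := by
        rw [hsa1, hsa2, (cfc_predicate g T : IsSelfAdjoint _).star_eq, hd, hd',
          ← cfc_mul _ _ T (hc _) (hc _), ← cfc_mul _ _ T (hc _) (hc _),
          ← cfc_mul _ _ T (hc _) (hc _), ← cfc_smul _ _ T (hc _), ← cfc_sub _ _ T (hc _) (hc _)]
        congr 1
        ext t; simp [hg]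
      have hp := (pos (cfc g T)).1
      rw [hgg, map_sub, ← Complex.coe_smul, map_smul, Complex.sub_re] at hp
      have hp' : ntwo τ (R - T) ^ 2 ≤ (2 * ntwo τ (T - T * T)) ^ 2 := by
        rw [mul_pow, ntwo_sq τ pos, ntwo_sq τ pos]
        simp only [smul_eq_mul, Complex.re_ofReal_mul, Complex.zero_re] at hp
        linarith
      exact le_of_sq_le_sq hp' (by have := ntwo_nonneg τ (T - T * T); positivity)
    have h2 : ntwo τ (T - T * T) ≤ ntwo τ (Q * P) := by
      have : T - T * T = e * P * (Q * P) * e := by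
        have : T * T = e * P * e * P * e := by
          rw [hT]
          calc e * P * e * (e * P * e) = e * P * (e * e) * P * e := by noncomm_ring
            _ = _ := by rw [he2]
        have h5 : e * P * e = e * P * (e + Q) * P * e := by
          rw [show e + Q = 1 by simp [he], mul_one, mul_assoc e P P, hP2]
        rw [this]
        calc T - e * P * e * P * e = e * P * (e + Q) * P * e - e * P * e * P * e := by
              rw [← h5]
          _ = _ := by noncomm_ring
      rw [this]
      refine (ntwo_mul_proj τ pos tr _ _ he1 he2).trans ?_
      rw [mul_assoc]
      exact (ntwo_proj_mul τ pos _ _ he1 he2).trans (ntwo_proj_mul τ pos _ _ hP1 hP2)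
    have h3 : ntwo τ (T - P) ≤ 2 * ntwo τ (Q * P) := by
      have : T - P = -(Q * P * e) - P * Q := by
        rw [hT]
        have : P = (e + Q) * P * (e + Q) := by simp [he]
        have e2 : P * Q = (e + Q) * P * Q := by simp [he]
        rw [e2]
        nth_rewrite 2 [this]
        noncomm_ring
      rw [this]
      refine (ntwo_sub τ pos _ _).trans ?_
      rw [ntwo_neg, hn']
      have := ntwo_mul_proj τ pos tr e (Q * P) he1 he2
      linarith
    have h4 : R - P = (R - T) + (T - P) := by abel
    rw [h4, ← hn]
    refine (ntwo_add τ pos _ _).trans ?_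
    linarith

end N2
section Seq

open Filter Topology

theorem ntwo_proj_le_one {A : Type} [CStarAlgebra A] (τ : A →ₗ[ℂ] ℂ)
    (pos : ∀ a : A, 0 ≤ τ (star a * a)) (h1 : τ 1 = 1) (e : A) (he : star e = e)
    (he2 : e * e = e) : ntwo τ e ≤ 1 := by
  have := ntwo_proj_mul τ pos e 1 he he2
  rw [mul_one] at this
  refine this.trans ?_
  simp [ntwo, h1]

theorem re_diff_le {A : Type} [CStarAlgebra A] (τ : A →ₗ[ℂ] ℂ)
    (pos : ∀ a : A, 0 ≤ τ (star a * a)) (tr : ∀ a b : A, τ (a * b) = τ (b * a))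
    (h1 : τ 1 = 1) (a b c d : A)
    (hb : star b = b) (hb2 : b * b = b) (hc : star c = c) (hc2 : c * c = c) :
    |(τ (a * b)).re - (τ (c * d)).re| ≤ ntwo τ (a - c) + ntwo τ (b - d) := by
  have e : τ (a * b) - τ (c * d) = τ ((a - c) * b) + τ (c * (b - d)) := by
    rw [← map_sub, ← map_add]; congr 1; noncomm_ring
  rw [← Complex.sub_re, e]
  refine (Complex.abs_re_le_norm _).trans ((norm_add_le _ _).trans ?_)
  have k1 := tau_mul_le τ pos (a - c) b
  have k2 := tau_mul_le τ pos c (b - d)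
  rw [ntwo_star τ tr] at k1 k2
  have := ntwo_proj_le_one τ pos h1 b hb hb2
  have := ntwo_proj_le_one τ pos h1 c hc hc2
  have := ntwo_nonneg τ (a - c)
  have := ntwo_nonneg τ (b - d)
  nlinarith

variable {B : ℕ → Type} [∀ k, CStarAlgebra (B k)] [∀ k, FiniteDimensional ℂ (B k)]
  (τ : ∀ k, B k →ₗ[ℂ] ℂ)

theorem tendsto_corr (pos : ∀ k, ∀ a : B k, 0 ≤ τ k (star a * a))
    (tr : ∀ k, ∀ a b : B k, τ k (a * b) = τ k (b * a)) (h1 : ∀ k, τ k 1 = 1)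
    (P Q P' Q' : ∀ k, B k) (L : ℝ)
    (hP : ∀ k, star (P k) = P k) (hP2 : ∀ k, P k * P k = P k)
    (hQ' : ∀ k, star (Q' k) = Q' k) (hQ2' : ∀ k, Q' k * Q' k = Q' k)
    (hQP : Tendsto (fun k => ntwo (τ k) (Q k - P k)) atTop (𝓝 0))
    (hQP' : Tendsto (fun k => ntwo (τ k) (Q' k - P' k)) atTop (𝓝 0))
    (hL : Tendsto (fun k => (τ k (P k * P' k)).re) atTop (𝓝 L)) :
    Tendsto (fun k => (τ k (Q k * Q' k)).re) atTop (𝓝 L) := by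
  have : Tendsto (fun k => (τ k (Q k * Q' k)).re - (τ k (P k * P' k)).re) atTop (𝓝 0) := by
    refine squeeze_zero_norm (fun k => ?_) (by simpa using hQP.add hQP')
    exact re_diff_le (τ k) (pos k) (tr k) (h1 k) _ _ _ _ (hQ' k) (hQ2' k) (hP k) (hP2 k)
  simpa using this.add hL

theorem orth_seq (pos : ∀ k, ∀ a : B k, 0 ≤ τ k (star a * a))
    (tr : ∀ k, ∀ a b : B k, τ k (a * b) = τ k (b * a)) (h1 : ∀ k, τ k 1 = 1)
    (m : ℕ) : ∀ (P : ∀ k, Fin m → B k)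
    (_ : ∀ k i, star (P k i) = P k i) (_ : ∀ k i, P k i * P k i = P k i)
    (_ : ∀ i j, i ≠ j → Tendsto (fun k => (τ k (P k i * P k j)).re) atTop (𝓝 0)),
    ∃ Q : ∀ k, Fin m → B k, (∀ k i, star (Q k i) = Q k i) ∧ (∀ k i, Q k i * Q k i = Q k i) ∧
      (∀ k i j, i ≠ j → Q k i * Q k j = 0) ∧
      ∀ i, Tendsto (fun k => ntwo (τ k) (Q k i - P k i)) atTop (𝓝 0) := by
  induction m with
  | zero =>
    intro P _ _ _
    exact ⟨P, fun _ i => i.elim0, fun _ i => i.elim0, fun _ i => i.elim0, fun i => i.elim0⟩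
  | succ m ih =>
    intro P hP hP2 hT
    obtain ⟨Q, hQ, hQ2, hQo, hQT⟩ := ih (fun k i => P k i.castSucc) (fun k i => hP k _)
      (fun k i => hP2 k _) (fun i j hij => hT _ _ (by simpa using hij))
    have hmul : ∀ k i, Q k i * (∑ j, Q k j) = Q k i := by
      intro k i
      rw [Finset.mul_sum, Finset.sum_eq_single i, hQ2]
      · intro j _ hj; exact hQo k i j hj.symm
      · simp
    have hs : ∀ k, star (∑ j, Q k j) = ∑ j, Q k j := by
      intro k; rw [star_sum]; exact Finset.sum_congr rfl fun i _ => hQ k i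
    have hs2 : ∀ k, (∑ j, Q k j) * (∑ j, Q k j) = ∑ j, Q k j := by
      intro k; rw [Finset.sum_mul]; exact Finset.sum_congr rfl fun i _ => hmul k i
    choose R hR hR2 hQR hRn using fun k => orth_step (τ k) (pos k) (tr k) (∑ j, Q k j)
      (P k (Fin.last m)) (hs k) (hs2 k) (hP k _) (hP2 k _)
    have hQR' : ∀ k i, Q k i * R k = 0 := by
      intro k i; rw [← hmul, mul_assoc, hQR, mul_zero]
    have hRQ' : ∀ k i, R k * Q k i = 0 := by
      intro k i
      have := congrArg star (hQR' k i)
      simpa [hR, hQ] using this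
    have hlim : Tendsto (fun k => (τ k ((∑ j, Q k j) * P k (Fin.last m))).re) atTop (𝓝 0) := by
      have h0 : Tendsto (fun k => ∑ j : Fin m, (τ k (Q k j * P k (Fin.last m))).re) atTop
          (𝓝 (∑ j : Fin m, (0 : ℝ))) := by
        refine tendsto_finsetSum _ fun i _ => ?_
        refine tendsto_corr τ pos tr h1 (fun k => P k i.castSucc) (fun k => Q k i)
          (fun k => P k (Fin.last m)) (fun k => P k (Fin.last m)) 0 (fun k => hP k _)
          (fun k => hP2 k _) (fun k => hP k _) (fun k => hP2 k _) (hQT i) ?_ ?_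
        · simp [ntwo_zero]
        · exact hT _ _ (Fin.castSucc_lt_last i).ne
      simp only [Finset.sum_const_zero] at h0
      refine h0.congr fun k => ?_
      rw [Finset.sum_mul, map_sum, Complex.re_sum]
    refine ⟨fun k => Fin.snoc (α := fun _ => B k) (Q k) (R k), ?_, ?_, ?_, ?_⟩
    · intro k i
      induction i using Fin.lastCases with
      | last => simp [hR]
      | cast i => simp [hQ]
    · intro k i
      induction i using Fin.lastCases with
      | last => simp [hR2]
      | cast i => simp [hQ2]
    · intro k i j hij
      induction i using Fin.lastCases with
      | last =>
        induction j using Fin.lastCases with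
        | last => simp at hij
        | cast j => simp [hRQ']
      | cast i =>
        induction j using Fin.lastCases with
        | last => simp [hQR']
        | cast j => simpa using hQo k i j (by simpa using hij)
    · intro i
      induction i using Fin.lastCases with
      | last =>
        simp only [Fin.snoc_last]
        refine squeeze_zero (fun k => ntwo_nonneg _ _) hRn ?_
        have := (Real.continuous_sqrt.tendsto 0).comp hlim
        simpa using this.const_mul 4
      | cast i => simpa using hQT i

theorem pvm_seq (pos : ∀ k, ∀ a : B k, 0 ≤ τ k (star a * a))
    (tr : ∀ k, ∀ a b : B k, τ k (a * b) = τ k (b * a)) (h1 : ∀ k, τ k 1 = 1)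
    (m : ℕ) (P : ∀ k, Fin (m + 1) → B k)
    (hP : ∀ k i, star (P k i) = P k i) (hP2 : ∀ k i, P k i * P k i = P k i)
    (hT : ∀ i j, i ≠ j → Tendsto (fun k => (τ k (P k i * P k j)).re) atTop (𝓝 0))
    (hT1 : Tendsto (fun k => ∑ i, (τ k (P k i * P k i)).re) atTop (𝓝 1)) :
    ∃ Q : ∀ k, Fin (m + 1) → B k, (∀ k i, star (Q k i) = Q k i) ∧
      (∀ k i, Q k i * Q k i = Q k i) ∧ (∀ k, ∑ i, Q k i = 1) ∧
      ∀ i, Tendsto (fun k => ntwo (τ k) (Q k i - P k i)) atTop (𝓝 0) := by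
  obtain ⟨Q, hQ, hQ2, hQo, hQT⟩ := orth_seq τ pos tr h1 (m + 1) P hP hP2 hT
  have hmul : ∀ k i, Q k i * (∑ j, Q k j) = Q k i := by
    intro k i
    rw [Finset.mul_sum, Finset.sum_eq_single i, hQ2]
    · intro j _ hj; exact hQo k i j hj.symm
    · simp
  have hs : ∀ k, star (∑ j, Q k j) = ∑ j, Q k j := by
    intro k; rw [star_sum]; exact Finset.sum_congr rfl fun i _ => hQ k i
  have hmul' : ∀ k i, (∑ j, Q k j) * Q k i = Q k i := by
    intro k i
    have := congrArg star (hmul k i)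
    rwa [star_mul, hs, hQ] at this
  have hs2 : ∀ k, (∑ j, Q k j) * (∑ j, Q k j) = ∑ j, Q k j := by
    intro k; rw [Finset.sum_mul]; exact Finset.sum_congr rfl fun i _ => hmul k i
  set S : ∀ k, B k := fun k => 1 - ∑ j, Q k j with hS
  have hS1 : ∀ k, star (S k) = S k := fun k => by simp only [hS, star_sub, star_one, hs]
  have hS2 : ∀ k, S k * S k = S k := fun k => by
    simp only [hS, mul_sub, sub_mul, hs2, mul_one, one_mul, sub_self, sub_zero]
  have hQS : ∀ k i, Q k i * S k = 0 := fun k i => by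
    simp only [hS, mul_sub, hmul, mul_one, sub_self]
  have hSQ : ∀ k i, S k * Q k i = 0 := fun k i => by
    simp only [hS, sub_mul, hmul', one_mul, sub_self]
  have hSn : Tendsto (fun k => ntwo (τ k) (S k)) atTop (𝓝 0) := by
    have h0 : Tendsto (fun k => ∑ i, (τ k (Q k i * Q k i)).re) atTop (𝓝 1) := by
      have hd : Tendsto (fun k => ∑ i, ((τ k (Q k i * Q k i)).re - (τ k (P k i * P k i)).re))
          atTop (𝓝 (∑ i : Fin (m + 1), ((0 : ℝ) + 0))) := by
        refine tendsto_finsetSum _ fun i _ => ?_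
        have h5 := (hQT i).add (hQT i)
        rw [add_zero] at h5 ⊢
        refine squeeze_zero_norm (fun k => ?_) h5
        exact re_diff_le (τ k) (pos k) (tr k) (h1 k) _ _ _ _ (hQ k i) (hQ2 k i) (hP k i)
          (hP2 k i)
      have := hd.add hT1
      simpa using this
    have h2 : ∀ k, ntwo (τ k) (S k) = Real.sqrt (1 - ∑ i, (τ k (Q k i * Q k i)).re) := by
      intro k
      rw [ntwo, hS1, hS2]
      simp [hS, h1, hQ2]
    have h3 := (Real.continuous_sqrt.tendsto (1 - 1)).comp (h0.const_sub 1)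
    simp only [sub_self, Real.sqrt_zero] at h3
    exact h3.congr fun k => (h2 k).symm
  refine ⟨fun k i => if i = 0 then Q k i + S k else Q k i, ?_, ?_, ?_, ?_⟩
  · intro k i; dsimp only; split_ifs
    · rw [star_add, hQ, hS1]
    · exact hQ k i
  · intro k i; dsimp only; split_ifs
    · rw [add_mul, mul_add, mul_add, hQ2, hQS, hSQ, hS2]; simp
    · exact hQ2 k i
  · intro k
    rw [Fin.sum_univ_succ]
    simp only [if_true, Fin.succ_ne_zero, if_false, hS]
    rw [Fin.sum_univ_succ]; abel
  · intro i
    dsimp only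
    split_ifs
    · refine squeeze_zero (fun k => ntwo_nonneg _ _) (fun k => ?_)
        (by simpa using (hQT i).add hSn)
      rw [add_sub_right_comm]
      exact ntwo_add (τ k) (pos k) _ _
    · exact hQT i

end Seq
section GNSQuot

open scoped InnerProductSpace

theorem gns_quot {A : Type} [CStarAlgebra A] (τ : A →ₗ[ℂ] ℂ)
    (pos : ∀ a : A, 0 ≤ τ (star a * a)) (tr : ∀ a b : A, τ (a * b) = τ (b * a)) :
    ∃ (C : Type) (_ : CStarAlgebra C) (π : A →⋆ₐ[ℂ] C) (σ : C →ₗ[ℂ] ℂ),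
      (∀ a, σ (π a) = τ a) ∧ (∀ c : C, 0 ≤ σ (star c * c)) ∧
      (∀ c d : C, σ (c * d) = σ (d * c)) ∧ (∀ a, ntwo τ a = 0 → π a = 0) := by
  obtain ⟨_, _, f, hf⟩ := exists_posMap τ pos
  have key : ∀ a, ntwo τ a = ‖f.toPreGNS a‖ := fun a => by
    rw [PositiveLinearMap.preGNS_norm_def, ntwo, hf]; simp
  let S : StarSubalgebra ℂ (f.GNS →L[ℂ] f.GNS) := f.gnsStarAlgHom.range.topologicalClosure
  have hSc : IsClosed (S : Set (f.GNS →L[ℂ] f.GNS)) :=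
    StarSubalgebra.isClosed_topologicalClosure _
  have hact : ∀ (a : A) (b : f.PreGNS), f.gnsStarAlgHom a (b : f.GNS) =
      ((f.leftMulMapPreGNS a b : f.PreGNS) : f.GNS) :=
    fun a b => f.gnsNonUnitalStarAlgHom_apply_coe
  let Ω : f.GNS := (f.toPreGNS 1 : f.PreGNS)
  have hle : ∀ a, f.gnsStarAlgHom a ∈ S := fun a =>
    StarSubalgebra.le_topologicalClosure _ ⟨a, rfl⟩
  have hval : ∀ a, ⟪Ω, f.gnsStarAlgHom a Ω⟫_ℂ = τ a := by
    intro a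
    have h2 : f.gnsStarAlgHom a Ω = ((f.toPreGNS a : f.PreGNS) : f.GNS) := by
      rw [hact]
      simp
    rw [h2, UniformSpace.Completion.inner_coe, PositiveLinearMap.preGNS_inner_def]
    simp [hf]
  have htr0 : ∀ c ∈ S, ∀ d ∈ S, ⟪Ω, (c * d) Ω⟫_ℂ = ⟪Ω, (d * c) Ω⟫_ℂ := by
    have step1 : ∀ a, ∀ d ∈ S, ⟪Ω, (f.gnsStarAlgHom a * d) Ω⟫_ℂ
        = ⟪Ω, (d * f.gnsStarAlgHom a) Ω⟫_ℂ := by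
      intro a d hd
      have hcl : IsClosed {d : f.GNS →L[ℂ] f.GNS | ⟪Ω, (f.gnsStarAlgHom a * d) Ω⟫_ℂ
        = ⟪Ω, (d * f.gnsStarAlgHom a) Ω⟫_ℂ} := by
        apply isClosed_eq <;> fun_prop
      refine closure_minimal ?_ hcl hd
      rintro _ ⟨b, rfl⟩
      change ⟪Ω, (f.gnsStarAlgHom a * f.gnsStarAlgHom b) Ω⟫_ℂ
        = ⟪Ω, (f.gnsStarAlgHom b * f.gnsStarAlgHom a) Ω⟫_ℂ
      rw [← map_mul, ← map_mul, hval, hval, tr]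
    intro c hc d hd
    have hcl : IsClosed {c : f.GNS →L[ℂ] f.GNS | ⟪Ω, (c * d) Ω⟫_ℂ = ⟪Ω, (d * c) Ω⟫_ℂ} := by
      apply isClosed_eq <;> fun_prop
    refine closure_minimal ?_ hcl hc
    rintro _ ⟨b, rfl⟩
    exact step1 b d hd
  refine ⟨S, StarSubalgebra.cstarAlgebra S (h_closed := hSc),
    f.gnsStarAlgHom.codRestrict S hle,
    { toFun := fun c => ⟪Ω, (c : f.GNS →L[ℂ] f.GNS) Ω⟫_ℂ
      map_add' := fun c d => by simp [inner_add_right]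
      map_smul' := fun c d => by simp [inner_smul_right] }, ?_, ?_, ?_, ?_⟩
  · intro a; exact hval a
  · intro c
    change 0 ≤ ⟪Ω, (star (c : f.GNS →L[ℂ] f.GNS) * (c : f.GNS →L[ℂ] f.GNS)) Ω⟫_ℂ
    rw [ContinuousLinearMap.star_eq_adjoint, mul_apply_eq_comp,
      ContinuousLinearMap.adjoint_inner_right]
    rw [inner_self_eq_norm_sq_to_K]
    norm_cast
    positivity
  · intro c d; exact htr0 c c.2 d d.2
  · intro a ha
    apply Subtype.ext
    change f.gnsStarAlgHom a = 0
    ext x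
    induction x using UniformSpace.Completion.induction_on with
    | hp => apply isClosed_eq <;> fun_prop
    | ih b =>
      rw [hact]
      rw [zero_apply, ← norm_eq_zero, UniformSpace.Completion.norm_coe]
      have := ntwo_null_mul τ pos tr a (f.ofPreGNS b) ha
      rw [key] at this
      exact this

end GNSQuot
section Main

open Filter Topology

noncomputable instance qcrepCStar {X : Type} {m : ℕ} (r : QCRep X m) : CStarAlgebra r.A where

/-- The two-outcome correlation obtained by coarse graining. -/
def coarse {X : Type} {m : ℕ} (p : X → X → Fin m → Fin m → ℝ) :
    (X × Fin m) → (X × Fin m) → Fin 2 → Fin 2 → ℝ := fun u v a b =>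
  if a = 0 then
    if b = 0 then p u.1 v.1 u.2 v.2 else p u.1 u.1 u.2 u.2 - p u.1 v.1 u.2 v.2
  else
    if b = 0 then p v.1 v.1 v.2 v.2 - p u.1 v.1 u.2 v.2
    else 1 - p u.1 u.1 u.2 u.2 - p v.1 v.1 v.2 v.2 + p u.1 v.1 u.2 v.2

theorem continuous_coarse {X : Type} {m : ℕ} : Continuous (coarse (X := X) (m := m)) := by
  refine continuous_pi fun u => continuous_pi fun v => continuous_pi fun a => continuous_pi fun b => ?_
  unfold coarse
  split_ifs <;> fun_prop

/-- The two-outcome representation obtained by coarse graining. -/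
@[reducible] noncomputable def coarseRep {X : Type} {m : ℕ} (r : QCRep X m) :
    QCRep (X × Fin m) 2 where
  A := r.A
  τ := r.τ
  E := fun u a => if a = 0 then r.E u.1 u.2 else 1 - r.E u.1 u.2
  unit := r.unit
  pos := r.pos
  tracial := r.tracial
  proj_sa := fun u a => by split_ifs <;> simp [r.proj_sa]
  proj_idem := fun u a => by split_ifs <;> simp [r.proj_idem, mul_sub, sub_mul]
  pvm := fun u => by simp [Fin.sum_univ_two]

theorem coarse_rep {X : Type} {m : ℕ} (r : QCRep X m) (p : X → X → Fin m → Fin m → ℝ)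
    (hp : ∀ x y i j, (p x y i j : ℂ) = r.τ (r.E x i * r.E y j)) (u v a b) :
    (coarse p u v a b : ℂ) = (coarseRep r).τ ((coarseRep r).E u a * (coarseRep r).E v b) := by
  have hd : ∀ x i, (p x x i i : ℂ) = r.τ (r.E x i) := fun x i => by rw [hp, r.proj_idem]
  simp only [coarse]
  split_ifs
  · exact hp _ _ _ _
  · push_cast; rw [hd, hp]; simp [mul_sub]
  · push_cast; rw [hd, hp]; simp [sub_mul]
  · push_cast; rw [hd, hd, hp]; simp [sub_mul, mul_sub, r.unit]; ring

theorem coarse_qc {X : Type} {m : ℕ} {p : X → X → Fin m → Fin m → ℝ} (h : p ∈ CqcsSet X m) :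
    coarse p ∈ CqcsSet (X × Fin m) 2 := by
  obtain ⟨r, hr⟩ := h
  exact ⟨coarseRep r, coarse_rep r p hr⟩

theorem coarse_q {X : Type} {m : ℕ} {p : X → X → Fin m → Fin m → ℝ} (h : p ∈ CqsSet X m) :
    coarse p ∈ CqsSet (X × Fin m) 2 := by
  obtain ⟨r, hr⟩ := h
  have := r.fd
  exact ⟨{ toQCRep := coarseRep r.toQCRep, fd := r.fd }, coarse_rep r.toQCRep p hr⟩

theorem coarse_qa {X : Type} {m : ℕ} {p : X → X → Fin m → Fin m → ℝ} (h : p ∈ CqasSet X m) :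
    coarse p ∈ CqasSet (X × Fin m) 2 :=
  map_mem_closure continuous_coarse h fun _ hq => coarse_q hq

theorem rep_sum_one {X : Type} {m : ℕ} (r : QCRep X m) (p : X → X → Fin m → Fin m → ℝ)
    (hp : ∀ x y i j, (p x y i j : ℂ) = r.τ (r.E x i * r.E y j)) (x : X) :
    ∑ i, p x x i i = 1 := by
  have : ((∑ i, p x x i i : ℝ) : ℂ) = 1 := by
    push_cast
    simp only [hp, r.proj_idem]
    rw [← map_sum, r.pvm, r.unit]
  exact_mod_cast this

theorem rep_sum_one' {X : Type} {m : ℕ} (r : QCRep X m) (p : X → X → Fin m → Fin m → ℝ)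
    (hp : ∀ x y i j, (p x y i j : ℂ) = r.τ (r.E x i * r.E y j)) (x : X) :
    ∑ i, ∑ j, p x x i j = 1 := by
  have : ((∑ i, ∑ j, p x x i j : ℝ) : ℂ) = 1 := by
    push_cast
    simp only [hp]
    simp only [← map_sum, ← Finset.mul_sum, r.pvm, mul_one, r.unit]
  exact_mod_cast this

theorem rep_nonneg {X : Type} {m : ℕ} (r : QCRep X m) (p : X → X → Fin m → Fin m → ℝ)
    (hp : ∀ x y i j, (p x y i j : ℂ) = r.τ (r.E x i * r.E y j)) (x y i j) :
    0 ≤ p x y i j := by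
  have h1 := r.pos (r.E x i * r.E y j)
  have : r.τ (star (r.E x i * r.E y j) * (r.E x i * r.E y j)) = r.τ (r.E x i * r.E y j) := by
    rw [star_mul, r.proj_sa, r.proj_sa, mul_assoc, ← mul_assoc (r.E x i), r.proj_idem,
      r.tracial, mul_assoc, r.proj_idem]
  rw [this, ← hp] at h1
  exact_mod_cast h1

theorem rep_orth {X : Type} {m : ℕ} (r : QCRep X m) (p : X → X → Fin m → Fin m → ℝ)
    (hp : ∀ x y i j, (p x y i j : ℂ) = r.τ (r.E x i * r.E y j)) (x i j) (hij : i ≠ j) :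
    p x x i j = 0 := by
  have h1 := rep_sum_one r p hp x
  have h2 := rep_sum_one' r p hp x
  have h3 : ∑ i, ∑ j, (if i = j then 0 else p x x i j) = 0 := by
    have : ∀ i, ∑ j, (if i = j then 0 else p x x i j) = ∑ j, p x x i j - p x x i i := by
      intro i
      have e : ∀ j, (if i = j then 0 else p x x i j) =
          p x x i j - (if i = j then p x x i j else 0) := by
        intro j; split_ifs <;> simp
      simp only [e, Finset.sum_sub_distrib, Finset.sum_ite_eq, Finset.mem_univ, if_true]
    simp only [this, Finset.sum_sub_distrib, h1, h2, sub_self]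
  have hnn : ∀ i j, 0 ≤ (if i = j then 0 else p x x i j) := by
    intro i j; split_ifs
    · exact le_rfl
    · exact rep_nonneg r p hp x x i j
  rw [Finset.sum_eq_zero_iff_of_nonneg (fun i _ => Finset.sum_nonneg fun j _ => hnn i j)] at h3
  have h4 := h3 i (Finset.mem_univ i)
  rw [Finset.sum_eq_zero_iff_of_nonneg (fun j _ => hnn i j)] at h4
  simpa [hij] using h4 j (Finset.mem_univ j)

theorem qa_sub_qc {X : Type} {m : ℕ} (h : CqasSet (X × Fin m) 2 ⊆ CqcsSet (X × Fin m) 2) :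
    CqasSet X m ⊆ CqcsSet X m := by
  intro p hp
  have hs1 : ∀ x, ∑ i, p x x i i = 1 := by
    intro x
    have hcl : IsClosed {p : X → X → Fin m → Fin m → ℝ | ∑ i, p x x i i = 1} :=
      isClosed_eq (by fun_prop) (by fun_prop)
    refine closure_minimal ?_ hcl hp
    rintro q ⟨r, hr⟩
    exact rep_sum_one r.toQCRep q hr x
  have hs2 : ∀ x, ∑ i, ∑ j, p x x i j = 1 := by
    intro x
    have hcl : IsClosed {p : X → X → Fin m → Fin m → ℝ | ∑ i, ∑ j, p x x i j = 1} :=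
      isClosed_eq (by fun_prop) (by fun_prop)
    refine closure_minimal ?_ hcl hp
    rintro q ⟨r, hr⟩
    exact rep_sum_one' r.toQCRep q hr x
  obtain ⟨r, hr⟩ := h (coarse_qa hp)
  obtain ⟨C, hC, π, σ, hσ, hpos, htr, hnull⟩ := gns_quot r.τ r.pos r.tracial
  have hr0 : ∀ x y i j, (p x y i j : ℂ) = r.τ (r.E (x, i) 0 * r.E (y, j) 0) := by
    intro x y i j
    have := hr (x, i) (y, j) 0 0
    simpa [coarse] using this
  have hone : ∀ x, ∑ i, π (r.E (x, i) 0) = 1 := by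
    intro x
    have h0 : π (∑ i, r.E (x, i) 0 - 1) = 0 := by
      apply hnull
      have e1 : star (∑ i, r.E (x, i) 0 - 1) * (∑ i, r.E (x, i) 0 - 1) =
          ∑ i, ∑ j, r.E (x, i) 0 * r.E (x, j) 0 - ∑ i, r.E (x, i) 0 * r.E (x, i) 0
          - ∑ i, r.E (x, i) 0 * r.E (x, i) 0 + 1 := by
        simp only [star_sub, star_sum, r.proj_sa, star_one, r.proj_idem, ← Finset.mul_sum,
          ← Finset.sum_mul]
        noncomm_ring
      have e2 : r.τ (star (∑ i, r.E (x, i) 0 - 1) * (∑ i, r.E (x, i) 0 - 1)) = 0 := by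
        rw [e1]
        simp only [map_add, map_sub, map_sum, ← hr0, r.unit]
        have h1 : (∑ i, (p x x i i : ℂ)) = 1 := by exact_mod_cast hs1 x
        have h2 : (∑ i, ∑ j, (p x x i j : ℂ)) = 1 := by exact_mod_cast hs2 x
        rw [h1, h2]; ring
      rw [ntwo, e2]; simp
    rw [map_sub, map_one, sub_eq_zero, map_sum] at h0
    exact h0
  refine ⟨{ A := C, τ := σ, E := fun x i => π (r.E (x, i) 0), unit := ?_, pos := hpos,
            tracial := htr, proj_sa := ?_, proj_idem := ?_, pvm := hone }, ?_⟩
  · rw [← map_one π, hσ, r.unit]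
  · intro x i; rw [← map_star, r.proj_sa]
  · intro x i; rw [← map_mul, r.proj_idem]
  · intro x y i j
    change (p x y i j : ℂ) = σ (π (r.E (x, i) 0) * π (r.E (y, j) 0))
    rw [← map_mul, hσ, hr0]

theorem qc_sub_qa {n m : ℕ} (h : CqcsSet (Fin n × Fin m) 2 ⊆ CqasSet (Fin n × Fin m) 2) :
    CqcsSet (Fin n) m ⊆ CqasSet (Fin n) m := by
  intro p hp
  have hq := h (coarse_qc hp)
  obtain ⟨r, hr⟩ := hp
  obtain ⟨q, hqm, hqt⟩ := mem_closure_iff_seq_limit.mp hq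
  choose s hs using hqm
  let P : ∀ x : Fin n, ∀ k, Fin m → (s k).A := fun x k i => (s k).E (x, i) 0
  have hfd : ∀ k, FiniteDimensional ℂ (s k).A := fun k => (s k).fd
  have hlim : ∀ x y i j, Tendsto (fun k => ((s k).τ (P x k i * P y k j)).re) atTop
      (𝓝 (p x y i j)) := by
    intro x y i j
    have h1 : Tendsto (fun k => q k (x, i) (y, j) 0 0) atTop
        (𝓝 (coarse p (x, i) (y, j) 0 0)) :=
      (tendsto_pi_nhds.mp (tendsto_pi_nhds.mp (tendsto_pi_nhds.mp
        (tendsto_pi_nhds.mp hqt (x, i)) (y, j)) 0) 0)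
    have h2 : coarse p (x, i) (y, j) 0 0 = p x y i j := by simp [coarse]
    rw [h2] at h1
    refine h1.congr fun k => ?_
    rw [← hs k, Complex.ofReal_re]
  have hpvm : ∀ x, ∃ Q : ∀ k, Fin m → (s k).A, (∀ k i, star (Q k i) = Q k i) ∧
      (∀ k i, Q k i * Q k i = Q k i) ∧ (∀ k, ∑ i, Q k i = 1) ∧
      ∀ i, Tendsto (fun k => ntwo (s k).τ (Q k i - P x k i)) atTop (𝓝 0) := by
    intro x
    cases m with
    | zero => exact absurd (rep_sum_one r p hr x) (by simp)
    | succ m =>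
      refine pvm_seq (fun k => (s k).τ) (fun k => (s k).pos) (fun k => (s k).tracial)
        (fun k => (s k).unit) m (P x) (fun k i => (s k).proj_sa _ _)
        (fun k i => (s k).proj_idem _ _) ?_ ?_
      · intro i j hij
        rw [← rep_orth r p hr x i j hij]
        exact hlim x x i j
      · rw [← rep_sum_one r p hr x]
        exact tendsto_finsetSum _ fun i _ => hlim x x i i
  choose Q hQ hQ2 hQ1 hQT using hpvm
  refine mem_closure_iff_seq_limit.mpr
    ⟨fun k x y i j => ((s k).τ (Q x k i * Q y k j)).re, fun k => ?_, ?_⟩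
  · refine ⟨{ A := (s k).A, τ := (s k).τ, E := fun x i => Q x k i, unit := (s k).unit,
              pos := (s k).pos, tracial := (s k).tracial, proj_sa := fun x i => hQ x k i,
              proj_idem := fun x i => hQ2 x k i, pvm := fun x => hQ1 x k, fd := (s k).fd }, ?_⟩
    intro x y i j
    change ((((s k).τ (Q x k i * Q y k j)).re : ℝ) : ℂ) = (s k).τ (Q x k i * Q y k j)
    apply tau_ofReal
    have h1 := (s k).pos (Q x k i * Q y k j)
    have : (s k).τ (star (Q x k i * Q y k j) * (Q x k i * Q y k j))
        = (s k).τ (Q x k i * Q y k j) := by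
      rw [star_mul, hQ, hQ, mul_assoc, ← mul_assoc (Q x k i), hQ2,
        (s k).tracial, mul_assoc, hQ2]
    rwa [this] at h1
  · refine tendsto_pi_nhds.mpr fun x => tendsto_pi_nhds.mpr fun y => tendsto_pi_nhds.mpr fun i =>
      tendsto_pi_nhds.mpr fun j => ?_
    exact tendsto_corr (fun k => (s k).τ) (fun k => (s k).pos) (fun k => (s k).tracial)
      (fun k => (s k).unit) (fun k => P x k i) (fun k => Q x k i) (fun k => P y k j)
      (fun k => Q y k j) _ (fun k => (s k).proj_sa _ _) (fun k => (s k).proj_idem _ _)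
      (fun k => hQ y k j) (fun k => hQ2 y k j) (hQT x i) (hQT y j) (hlim x y i j)

end Main

/-- if C_qa^s(n,m) ≠ C_qc^s(n,m), then (identifying Fin (nm) with
Fin n × Fin m) C_qa^s(nm,2) ≠ C_qc^s(nm,2). -/
theorem stmt11 (n m : ℕ) (h : CqasSet (Fin n) m ≠ CqcsSet (Fin n) m) :
    CqasSet (Fin n × Fin m) 2 ≠ CqcsSet (Fin n × Fin m) 2 := by
  exact fun h2 => h (Set.Subset.antisymm (qa_sub_qc h2.le) (qc_sub_qa h2.ge))
end

section
/- Fix n ∈ ℕ, y ∈ [0,1]^n, and a real vector x = (x_{ij})_{0 ≤ i < j < n}; extend x symmetrically by x_{ji} := x_{ij}. Let A be a unital C*-algebra carrying a faithful tracial state τ, and let P_0, …, P_{n−1} ∈ A be projections with τ(P_i) = y_i for each i and ∑_{i<j} x_{ij} τ(P_i P_j) = u_qc(y,x), where u_qc(y,x) := sup{ ∑_{i<j} x_{ij} w_{ij} : w ∈ S_y[D_qc(n)] }. Then for every i, the element P_i commutes with ∑_{j ≠ i} x_{ij} P_j. -/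
open scoped ComplexOrder BigOperators

/-- A tracial representation of n projections: a unital C*-algebra with a tracial
state τ and projections P 0, …, P (n-1). -/
structure ProjRep (n : ℕ) where
  A : Type
  [ring : NormedRing A]
  [starRing : StarRing A]
  [cstar : CStarRing A]
  [alg : NormedAlgebra ℂ A]
  [complete : CompleteSpace A]
  [smod : StarModule ℂ A]
  τ : A →ₗ[ℂ] ℂ
  P : Fin n → A
  unit : τ 1 = 1
  pos : ∀ a : A, 0 ≤ τ (star a * a)
  tracial : ∀ a b : A, τ (a * b) = τ (b * a)
  proj_sa : ∀ i, star (P i) = P i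
  proj_idem : ∀ i, P i * P i = P i

attribute [instance] ProjRep.ring ProjRep.starRing ProjRep.cstar ProjRep.alg
  ProjRep.complete ProjRep.smod

/-- D_qc(n): real symmetric n×n matrices of the form w i j = τ(P i * P j). -/
def Dqc (n : ℕ) : Set (Matrix (Fin n) (Fin n) ℝ) :=
  {w | w.IsSymm ∧ ∃ r : ProjRep n, ∀ i j, (w i j : ℂ) = r.τ (r.P i * r.P j)}

/-- The y-slice S_y[D] of a set D of n×n matrices: vectors (w i j)_{i<j} that extend
to an element of D with diagonal y (entries with ¬(i<j) are unconstrained). -/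
def ySlice {n : ℕ} (D : Set (Matrix (Fin n) (Fin n) ℝ)) (y : Fin n → ℝ) :
    Set (Fin n → Fin n → ℝ) :=
  {w | ∃ p ∈ D, (∀ i j : Fin n, i < j → p i j = w i j) ∧ ∀ i, p i i = y i}

/-- u(y,x) := sup { ∑_{i<j} x i j * w i j : w ∈ S_y[D] }. -/
noncomputable def uVal {n : ℕ} (D : Set (Matrix (Fin n) (Fin n) ℝ))
    (y : Fin n → ℝ) (x : Fin n → Fin n → ℝ) : ℝ :=
  sSup ((fun w => ∑ i, ∑ j, if i < j then x i j * w i j else 0) '' ySlice D y)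

set_option linter.style.haveILetI false

section helpers

/-- Transport a tracial representation on a small C*-algebra to `Type`. -/
lemma exists_projRep_of_small {n : ℕ} {B : Type*} [CStarAlgebra B] [Small.{0} B]
    (τ : B →ₗ[ℂ] ℂ) (hunit : τ 1 = 1) (hpos : ∀ a : B, 0 ≤ τ (star a * a))
    (htr : ∀ a b : B, τ (a * b) = τ (b * a)) (P : Fin n → B)
    (hsa : ∀ i, star (P i) = P i) (hid : ∀ i, P i * P i = P i) :
    ∃ r : ProjRep n, ∀ i j, r.τ (r.P i * r.P j) = τ (P i * P j) := by
  let e : Shrink.{0} B ≃ₐ[ℂ] B := Shrink.algEquiv ℂ B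
  letI i1 : NormedRing (Shrink.{0} B) := NormedRing.induced _ _ e e.injective
  letI i2 : NormedAlgebra ℂ (Shrink.{0} B) := NormedAlgebra.induced ℂ _ _ e
  letI i3 : StarRing (Shrink.{0} B) :=
    { star := fun a => e.symm (star (e a))
      star_involutive := fun a => by simp
      star_mul := fun a b => by simp
      star_add := fun a b => by simp }
  have hstar : ∀ a : Shrink.{0} B, e (star a) = star (e a) := fun a => e.apply_symm_apply _
  have hnorm : ∀ a : Shrink.{0} B, ‖a‖ = ‖e a‖ := fun a => rfl
  haveI i4 : CStarRing (Shrink.{0} B) := ⟨fun a => by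
    rw [hnorm, hnorm, map_mul, hstar]
    exact CStarRing.norm_mul_self_le (e a)⟩
  haveI i5 : StarModule ℂ (Shrink.{0} B) := ⟨fun c a => by
    apply e.injective
    rw [hstar, map_smul, map_smul, hstar, star_smul]⟩
  have hiso : Isometry e := AddMonoidHomClass.isometry_of_norm e (fun a => (hnorm a).symm)
  haveI i6 : CompleteSpace (Shrink.{0} B) := by
    have h := hiso.isUniformInducing
    rw [completeSpace_iff_isComplete_range h]
    rw [e.surjective.range_eq]
    exact completeSpace_iff_isComplete_univ.mp inferInstance
  refine ⟨{ A := Shrink.{0} B, τ := τ.comp e.toLinearMap, P := fun i => e.symm (P i), unit := ?_, pos := ?_, tracial := ?_, proj_sa := ?_, proj_idem := ?_ }, ?_⟩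
  · simp [hunit]
  · intro a
    simpa [hstar] using hpos (e a)
  · intro a b
    simpa using htr (e a) (e b)
  · intro i
    apply e.injective
    rw [hstar]
    simp [hsa]
  · intro i
    apply e.injective
    simp [hid]
  · intro i j
    simp

lemma small_closure {X : Type*} [MetricSpace X] (s : Set X) [Small.{0} s] :
    Small.{0} (closure s) := by
  classical
  let f : (ℕ → s) → X := fun u => if h : ∃ a, Filter.Tendsto (fun k => (u k : X)) Filter.atTop (nhds a) then h.choose else u 0
  have : closure s ⊆ Set.range f := by
    intro a ha
    obtain ⟨u, hu, hlim⟩ := mem_closure_iff_seq_limit.mp ha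
    refine ⟨fun k => ⟨u k, hu k⟩, ?_⟩
    have h : ∃ a, Filter.Tendsto (fun k => u k) Filter.atTop (nhds a) := ⟨a, hlim⟩
    have : f (fun k => ⟨u k, hu k⟩) = h.choose := dif_pos h
    rw [this]
    exact tendsto_nhds_unique h.choose_spec hlim
  exact small_subset this

lemma exists_projRep {n : ℕ} {B : Type*} [CStarAlgebra B]
    (τ : B →ₗ[ℂ] ℂ) (hunit : τ 1 = 1) (hpos : ∀ a : B, 0 ≤ τ (star a * a))
    (htr : ∀ a b : B, τ (a * b) = τ (b * a)) (P : Fin n → B)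
    (hsa : ∀ i, star (P i) = P i) (hid : ∀ i, P i * P i = P i) :
    ∃ r : ProjRep n, ∀ i j, r.τ (r.P i * r.P j) = τ (P i * P j) := by
  let S0 := StarAlgebra.adjoin ℂ (Set.range P)
  let S := S0.topologicalClosure
  have hS0 : Small.{0} (S0 : Set B) := by
    have h1 : star (Set.range P) = Set.range P := by
      ext a
      constructor
      · rintro ⟨i, hi⟩
        exact ⟨i, by rw [← star_star a, ← hi, hsa]⟩
      · rintro ⟨i, rfl⟩
        exact ⟨i, (hsa i).symm⟩
    have h2 : (S0 : Set B) = Set.range (FreeAlgebra.lift ℂ P) := by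
      have := StarAlgebra.adjoin_toSubalgebra ℂ (Set.range P)
      rw [h1, Set.union_self, Algebra.adjoin_range_eq_range_freeAlgebra_lift] at this
      exact congrArg (fun T : Subalgebra ℂ B => (T : Set B)) this
    rw [h2]
    exact small_range _
  have hS : Small.{0} S := small_closure (S0 : Set B)
  haveI : IsClosed (S : Set B) := S0.isClosed_topologicalClosure
  have hP : ∀ i, P i ∈ S := fun i => S0.le_topologicalClosure
    (StarAlgebra.subset_adjoin ℂ _ ⟨i, rfl⟩)
  obtain ⟨r, hr⟩ := exists_projRep_of_small (B := S) (n := n)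
    (τ.comp S.subtype.toLinearMap) (by simpa using hunit)
    (fun a => by simpa using hpos (a : B))
    (fun a b => by simpa using htr (a : B) b)
    (fun i => ⟨P i, hP i⟩) (fun i => Subtype.ext (hsa i)) (fun i => Subtype.ext (hid i))
  exact ⟨r, fun i j => by rw [hr]; simp⟩

lemma bdd_values {n : ℕ} (y : Fin n → ℝ) (x : Fin n → Fin n → ℝ) :
    BddAbove ((fun w : Fin n → Fin n → ℝ =>
      ∑ i, ∑ j, if i < j then x i j * w i j else 0) '' ySlice (Dqc n) y) := by
  refine ⟨∑ i, ∑ j, |x i j| * ((y i + y j) / 2), ?_⟩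
  rintro _ ⟨w, ⟨p, ⟨hps, r, hr⟩, hpw, hpy⟩, rfl⟩
  have key : ∀ i j, |p i j| ≤ (y i + y j) / 2 := by
    intro i j
    have h1 := r.pos (r.P i - r.P j)
    have h2 := r.pos (r.P i + r.P j)
    rw [star_sub, r.proj_sa, r.proj_sa, mul_sub, sub_mul, sub_mul, map_sub, map_sub, map_sub,
      ← hr, ← hr, ← hr, ← hr, hps.apply i j, hpy, hpy] at h1
    rw [star_add, r.proj_sa, r.proj_sa, mul_add, add_mul, add_mul, map_add, map_add, map_add,
      ← hr, ← hr, ← hr, ← hr, hps.apply i j, hpy, hpy] at h2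
    norm_cast at h1 h2
    rw [abs_le]
    constructor <;> linarith
  have h0 : ∀ i, 0 ≤ y i := fun i => by
    have := (abs_nonneg _).trans (key i i); linarith
  refine Finset.sum_le_sum fun i _ => Finset.sum_le_sum fun j _ => ?_
  split_ifs with hij
  · rw [← hpw i j hij]
    refine (le_abs_self _).trans ?_
    rw [abs_mul]
    exact mul_le_mul_of_nonneg_left (key i j) (abs_nonneg _)
  · have := h0 i
    have := h0 j
    positivity

lemma trace_sa {B : Type*} [CStarAlgebra B] (τ : B →ₗ[ℂ] ℂ)
    (hpos : ∀ a : B, 0 ≤ τ (star a * a)) (a b : B) (ha : star a = a) (hb : star b = b)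
    (htr : ∀ a b : B, τ (a * b) = τ (b * a)) :
    (τ (a * b)).im = 0 := by
  have h1 := (Complex.nonneg_iff.mp (hpos (a + b))).2
  have h2 := (Complex.nonneg_iff.mp (hpos (a - b))).2
  rw [star_add, ha, hb, add_mul, mul_add, mul_add, map_add, map_add, map_add, htr b a] at h1
  rw [star_sub, ha, hb, sub_mul, mul_sub, mul_sub, map_sub, map_sub, map_sub, htr b a] at h2
  simp only [Complex.add_im, Complex.sub_im] at h1 h2
  linarith

lemma le_uVal {n : ℕ} (y : Fin n → ℝ) (x : Fin n → Fin n → ℝ) {B : Type*} [CStarAlgebra B]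
    (τ : B →ₗ[ℂ] ℂ) (hunit : τ 1 = 1) (hpos : ∀ a : B, 0 ≤ τ (star a * a))
    (htr : ∀ a b : B, τ (a * b) = τ (b * a)) (P : Fin n → B)
    (hsa : ∀ i, star (P i) = P i) (hid : ∀ i, P i * P i = P i)
    (hPy : ∀ i, τ (P i) = (y i : ℂ)) :
    ∑ i, ∑ j, (if i < j then x i j * (τ (P i * P j)).re else 0) ≤ uVal (Dqc n) y x := by
  obtain ⟨r, hr⟩ := exists_projRep τ hunit hpos htr P hsa hid
  refine le_csSup (bdd_values y x) ⟨fun i j => (τ (P i * P j)).re,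
    ⟨fun i j => (τ (P i * P j)).re, ⟨?_, r, ?_⟩, fun _ _ _ => rfl, ?_⟩, rfl⟩
  · ext i j
    change (τ (P j * P i)).re = (τ (P i * P j)).re
    rw [htr]
  · intro i j
    rw [hr]
    apply Complex.ext
    · simp
    · simpa using (trace_sa τ hpos _ _ (hsa i) (hsa j) htr).symm
  · intro i
    simp [hid, hPy]

lemma sum_lt_single {n : ℕ} (i : Fin n) (h : Fin n → Fin n → ℝ) (hsymm : ∀ a b, h a b = h b a)
    (h0 : ∀ a b, a ≠ i → b ≠ i → h a b = 0) :
    ∑ a, ∑ b, (if a < b then h a b else 0) =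
      ∑ j ∈ Finset.univ.filter (fun j => j ≠ i), h i j := by
  have e1 : ∀ a b, (if a < b then h a b else 0) =
      (if a = i then (if i < b then h i b else 0) else 0) +
      (if b = i then (if a < i then h i a else 0) else 0) := by
    intro a b
    by_cases ha : a = i
    · subst ha
      by_cases hb : b = a
      · subst hb; simp
      · simp [hb]
    · by_cases hb : b = i
      · subst hb; rw [hsymm a b]; simp [ha]
      · simp [ha, hb, h0 a b ha hb]
  rw [Finset.sum_congr rfl fun a _ => Finset.sum_congr rfl fun b _ => e1 a b]
  simp_rw [Finset.sum_add_distrib]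
  rw [add_comm]
  rw [Finset.sum_comm (f := fun a b => if a = i then (if i < b then h i b else 0) else 0)]
  simp only [Finset.sum_ite_eq', Finset.mem_univ, if_true]
  rw [← Finset.sum_add_distrib, Finset.sum_filter]
  refine Finset.sum_congr rfl fun j _ => ?_
  rcases lt_trichotomy j i with hj | hj | hj
  · simp [hj, hj.ne, hj.not_gt]
  · simp [hj]
  · simp [hj, hj.ne', hj.not_gt]

lemma continuous_of_pos {B : Type*} [CStarAlgebra B] (τ : B →ₗ[ℂ] ℂ)
    (hpos : ∀ a : B, 0 ≤ τ (star a * a)) : Continuous τ := by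
  letI := CStarAlgebra.spectralOrder B
  haveI := CStarAlgebra.spectralOrderedRing B
  let f : B →ₚ[ℂ] ℂ := PositiveLinearMap.mk₀ τ (fun a ha => by
    obtain ⟨b, rfl⟩ := CStarAlgebra.nonneg_iff_eq_star_mul_self.mp ha
    exact hpos b)
  exact map_continuous f

lemma commute_of_max {B : Type*} [CStarAlgebra B] (τ : B →ₗ[ℂ] ℂ)
    (hpos : ∀ a : B, 0 ≤ τ (star a * a))
    (htr : ∀ a b : B, τ (a * b) = τ (b * a))
    (hfaithful : ∀ a : B, τ (star a * a) = 0 → a = 0)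
    (P S : B) (hP : star P = P) (hS : star S = S)
    (hid : P * P = P)
    (hmax : ∀ Q : B, star Q = Q → Q * Q = Q → τ Q = τ P → (τ (Q * S)).re ≤ (τ (P * S)).re) :
    Commute P S := by
  letI : NormedAlgebra ℚ B := NormedAlgebra.restrictScalars ℚ ℝ B
  set K : B := P * S - S * P with hK
  have hKs : star K = -K := by simp [hK, hP, hS]
  let L : B →L[ℝ] ℂ := (⟨τ, continuous_of_pos τ hpos⟩ : B →L[ℂ] ℂ).restrictScalars ℝ
  have hL : ∀ a, L a = τ a := fun a => rfl
  let V : ℝ → B := fun t => NormedSpace.exp (t • K)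
  let W : ℝ → B := fun t => NormedSpace.exp (t • (-K))
  have hV0 : V 0 = 1 := by simp [V]
  have hW0 : W 0 = 1 := by simp [W]
  have hVd : HasDerivAt V K 0 := by
    have := hasDerivAt_exp_smul_const (𝕂 := ℝ) K (0 : ℝ)
    simpa using this
  have hWd : HasDerivAt W (-K) 0 := by
    have := hasDerivAt_exp_smul_const (𝕂 := ℝ) (-K) (0 : ℝ)
    rwa [zero_smul, NormedSpace.exp_zero, one_mul] at this
  have hVs : ∀ t, star (V t) = W t := fun t => by
    simp only [V, W, NormedSpace.star_exp, star_smul, hKs, star_trivial]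
  have hWs : ∀ t, star (W t) = V t := fun t => by rw [← hVs, star_star]
  have hu : ∀ t, V t ∈ unitary B := fun t =>
    NormedSpace.exp_mem_unitary_of_mem_skewAdjoint (by
      rw [skewAdjoint.mem_iff, star_smul, hKs, star_trivial, smul_neg])
  have hWV : ∀ t, W t * V t = 1 := fun t => by
    rw [← hVs]; exact (Unitary.mem_iff.mp (hu t)).1
  let g : ℝ → ℝ := fun t => (L (V t * P * W t * S)).re
  have hgd : HasDerivAt g (Complex.reCLM (L ((K * P * 1 + 1 * P * (-K)) * S))) 0 := by
    have h1 := ((hVd.mul_const P).mul hWd).mul_const S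
    rw [hV0, hW0] at h1
    exact (Complex.reCLM.hasFDerivAt.comp_hasDerivAt (0 : ℝ) (L.hasFDerivAt.comp_hasDerivAt (0 : ℝ) h1))
  have hgm : IsLocalMax g 0 := by
    refine Filter.Eventually.of_forall fun t => ?_
    have h := hmax (V t * P * W t) (by simp [hVs, hWs, hP, mul_assoc])
      (by
        calc V t * P * W t * (V t * P * W t) = V t * P * (W t * V t) * P * W t := by
              simp only [mul_assoc]
          _ = V t * (P * P) * W t := by rw [hWV]; simp only [mul_assoc, one_mul, mul_one]
          _ = _ := by rw [hid])
      (by rw [htr, ← mul_assoc, hWV, one_mul])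
    simpa [g, hL, hV0, hW0] using h
  have hz := hgm.hasDerivAt_eq_zero hgd
  have hval : τ ((K * P * 1 + 1 * P * (-K)) * S) = - τ (star K * K) := by
    rw [hKs]
    have : (K * P * 1 + 1 * P * (-K)) * S = K * (P * S) - P * (K * S) := by noncomm_ring
    rw [this, map_sub, htr P (K * S), ← map_sub, ← map_neg]
    congr 1
    conv_rhs => rw [neg_mul, neg_neg]
    conv_rhs => rhs; rw [hK]
    noncomm_ring
  rw [hL, hval] at hz
  have hz' : (τ (star K * K)).re = 0 := by simpa using hz
  have h0 : K = 0 := hfaithful K (Complex.ext hz' (Complex.nonneg_iff.mp (hpos K)).2.symm)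
  exact sub_eq_zero.mp h0

end helpers

/-- if the projections P 0, …, P (n-1) with τ(P i) = y i attain the value
u_qc(y,x), then each P i commutes with ∑_{j ≠ i} x i j • P j. -/
theorem stmt14 {n : ℕ} (y : Fin n → ℝ) (hy : ∀ i, y i ∈ Set.Icc (0 : ℝ) 1)
    (x : Fin n → Fin n → ℝ) (hxsymm : ∀ i j, x j i = x i j)
    {A : Type*} [NormedRing A] [StarRing A] [CStarRing A]
    [NormedAlgebra ℂ A] [CompleteSpace A] [StarModule ℂ A]
    (τ : A →ₗ[ℂ] ℂ)
    (hunit : τ 1 = 1)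
    (hpos : ∀ a : A, 0 ≤ τ (star a * a))
    (htracial : ∀ a b : A, τ (a * b) = τ (b * a))
    (hfaithful : ∀ a : A, τ (star a * a) = 0 → a = 0)
    (P : Fin n → A)
    (hPsa : ∀ i, star (P i) = P i) (hPidem : ∀ i, P i * P i = P i)
    (hPy : ∀ i, τ (P i) = (y i : ℂ))
    (hattain : ∑ i, ∑ j, (if i < j then x i j * (τ (P i * P j)).re else 0) =
      uVal (Dqc n) y x) :
    ∀ i, Commute (P i)
      (∑ j ∈ Finset.univ.filter (fun j => j ≠ i), (x i j : ℂ) • P j) := by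

  intro i
  letI : CStarAlgebra A := {}
  set S := ∑ j ∈ Finset.univ.filter (fun j => j ≠ i), (x i j : ℂ) • P j with hS
  refine commute_of_max τ hpos htracial hfaithful (P i) S (hPsa i) ?_ (hPidem i) ?_
  · simp [hS, star_sum, star_smul, hPsa]
  intro Q hQs hQi hQτ
  have hle := le_uVal y x τ hunit hpos htracial (Function.update P i Q)
    (fun j => by
      by_cases hj : j = i
      · subst hj; simpa using hQs
      · simpa [hj] using hPsa j)
    (fun j => by
      by_cases hj : j = i
      · subst hj; simpa using hQi
      · simpa [hj] using hPidem j)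
    (fun j => by
      by_cases hj : j = i
      · subst hj; simpa using hQτ.trans (hPy j)
      · simpa [hj] using hPy j)
  rw [← hattain, ← sub_nonpos, ← Finset.sum_sub_distrib] at hle
  simp_rw [← Finset.sum_sub_distrib] at hle
  have hs := sum_lt_single i
    (fun a b => x a b * (τ (Function.update P i Q a * Function.update P i Q b)).re
      - x a b * (τ (P a * P b)).re)
    (fun a b => by
      simp only [hxsymm b a, htracial (P b) (P a),
        htracial (Function.update P i Q b) (Function.update P i Q a)])
    (fun a b ha hb => by simp [ha, hb])
  have he : ∀ R : A, (τ (R * S)).re =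
      ∑ j ∈ Finset.univ.filter (fun j => j ≠ i), x i j * (τ (R * P j)).re := by
    intro R
    simp [hS, Finset.mul_sum, map_sum, Complex.re_sum]
  rw [← sub_nonpos, he, he, ← Finset.sum_sub_distrib]
  refine le_trans (le_of_eq ?_) hle
  refine Eq.trans ?_ (hs.symm.trans ?_)
  · refine Finset.sum_congr rfl fun j hj => ?_
    have hj' : j ≠ i := by simpa using hj
    simp [hj']
  · refine Finset.sum_congr rfl fun a _ => Finset.sum_congr rfl fun b _ => ?_
    split_ifs <;> simp
end

section
/- D_q(3) = D_qc(3); that is, every real symmetric 3×3 matrix w of the form w_{ij} = τ(P_i P_j) for projections P_0, P_1, P_2 in a unital C*-algebra with tracial state τ can also be realized as w_{ij} = ρ(Q_i Q_j) for projections Q_0, Q_1, Q_2 in a finite-dimensional unital C*-algebra with tracial state ρ. Consequently D_q(3) is a closed subset of the real 3×3 matrices. -/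
open scoped ComplexOrder BigOperators

/-- A finite-dimensional tracial representation of n projections. -/
structure FinProjRep (n : ℕ) extends ProjRep n where
  [fd : FiniteDimensional ℂ toProjRep.A]

/-- D_q(n): the same with a finite-dimensional C*-algebra. -/
def Dq (n : ℕ) : Set (Matrix (Fin n) (Fin n) ℝ) :=
  {w | w.IsSymm ∧ ∃ r : FinProjRep n, ∀ i j, (w i j : ℂ) = r.τ (r.P i * r.P j)}

section helpers
open Set

theorem compactHull {E : Type*} [AddCommGroup E] [Module ℝ E] [TopologicalSpace E]
    [IsTopologicalAddGroup E] [ContinuousSMul ℝ E] [FiniteDimensional ℝ E]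
    {S : Set E} (hS : IsCompact S) : IsCompact (convexHull ℝ S) := by
  let f : ∀ n : ℕ, (Fin n → ℝ) × (Fin n → E) → E := fun n p => ∑ i, p.1 i • p.2 i
  have hf : ∀ n, Continuous (f n) := fun n => by unfold f; fun_prop
  have key : convexHull ℝ S = ⋃ n ∈ Finset.range (Module.finrank ℝ E + 2),
      f n '' (stdSimplex ℝ (Fin n) ×ˢ (Set.univ.pi fun _ => S)) := by
    apply Set.Subset.antisymm
    · intro x hx
      obtain ⟨ι, _, z, w, hz, hai, hw, hw1, rfl⟩ := eq_pos_convex_span_of_mem_convexHull hx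
      have hc := hai.card_le_finrank_succ
      have hc2 : Fintype.card ι ≤ Module.finrank ℝ E + 1 :=
        hc.trans (Nat.succ_le_succ (Submodule.finrank_le _))
      simp only [Set.mem_iUnion, Finset.mem_range]
      refine ⟨Fintype.card ι, by omega, ?_⟩
      let e := Fintype.equivFin ι
      refine ⟨(w ∘ e.symm, z ∘ e.symm), ⟨⟨fun i => (hw _).le, ?_⟩, fun i _ => hz ⟨_, rfl⟩⟩, ?_⟩
      · simpa using (Equiv.sum_comp e.symm w).trans hw1
      · exact Equiv.sum_comp e.symm (fun i => w i • z i)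
    · simp only [Set.iUnion_subset_iff]
      rintro n - _ ⟨⟨w, z⟩, ⟨hw, hz⟩, rfl⟩
      exact (convex_convexHull ℝ S).sum_mem (fun i _ => hw.1 i) hw.2
        (fun i _ => subset_convexHull ℝ S (hz i trivial))
  rw [key]
  refine (Finset.range _).isCompact_biUnion fun n _ => ?_
  exact ((isCompact_stdSimplex ℝ _).prod (isCompact_univ_pi fun _ => hS)).image (hf n)


theorem scal1 (a y e m : ℝ) (he : 0 < e) (hm : m = max |a| |y| + e) :
    m + a * y / m ≤ |a + y| + 2 * e := by
  have hm0 : 0 < m := by rw [hm]; positivity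
  have : m + a * y / m - (|a+y| + 2*e) = (m*m + a*y - m*(|a+y|+2*e))/m := by field_simp
  have key : m*m + a*y - m*(|a+y|+2*e) ≤ 0 := by
    have h1 := le_abs_self (a+y)
    have h2 := neg_abs_le (a+y)
    rcases le_total |a| |y| with h | h
    · rw [max_eq_right h] at hm
      rcases abs_cases a with ha | ha <;> rcases abs_cases y with hy | hy <;> subst hm <;> rw [ha.1, hy.1] at h <;> rw [hy.1] at * <;> nlinarith [abs_nonneg (a+y)]
    · rw [max_eq_left h] at hm
      rcases abs_cases a with ha | ha <;> rcases abs_cases y with hy | hy <;> subst hm <;> rw [ha.1, hy.1] at h <;> rw [ha.1] at * <;> nlinarith [abs_nonneg (a+y)]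
  have := div_nonpos_of_nonpos_of_nonneg key hm0.le
  linarith

theorem lemE (F G : ℝ → ℝ) (hF : Continuous F) (hG : Continuous G) (e : ℝ) (he : 0 < e)
    (h0 : ∀ x ∈ Icc (-1:ℝ) 1, -e ≤ F x) (h1 : |G 1| - e ≤ F 1) (h2 : |G (-1)| - e ≤ F (-1)) :
    ∃ N : ℕ, ∀ x ∈ Icc (-1:ℝ) 1, -(2*e) ≤ F x - |G x| * x^(2*N) := by
  have c1 : ∀ᶠ x in nhds (1:ℝ), -(2*e) < F x - |G x| := by
    apply (Continuous.tendsto (by fun_prop : Continuous fun x => F x - |G x|) 1).eventually_const_lt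
    linarith
  have c2 : ∀ᶠ x in nhds (-1:ℝ), -(2*e) < F x - |G x| := by
    apply (Continuous.tendsto (by fun_prop : Continuous fun x => F x - |G x|) (-1)).eventually_const_lt
    linarith
  obtain ⟨d1, hd1, k1⟩ := Metric.eventually_nhds_iff.1 c1
  obtain ⟨d2, hd2, k2⟩ := Metric.eventually_nhds_iff.1 c2
  obtain ⟨M, hM⟩ := (isCompact_Icc (a := (-1:ℝ)) (b := 1)).exists_bound_of_continuousOn hG.continuousOn
  set d := min (min d1 d2) 1 with hd
  have hd0 : 0 < d := by positivity
  have hdd1 : d ≤ d1 := (min_le_left _ _).trans (min_le_left _ _)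
  have hdd2 : d ≤ d2 := (min_le_left _ _).trans (min_le_right _ _)
  have hdd3 : d ≤ 1 := min_le_right _ _
  have hM0 : 0 ≤ M := (norm_nonneg _).trans (hM 0 (by simp))
  obtain ⟨N, hN⟩ := exists_pow_lt_of_lt_one (show 0 < e/(M+1) by positivity) (show 1 - d < 1 by linarith)
  refine ⟨N, fun x hx => ?_⟩
  have hGx : |G x| ≤ M := hM x hx
  have hGx0 := abs_nonneg (G x)
  have hxabs : |x| ≤ 1 := abs_le.2 hx
  have hp : x^(2*N) = |x|^(2*N) := by rw [pow_mul, pow_mul, sq_abs]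
  have hp1 : |x|^(2*N) ≤ 1 := pow_le_one₀ (abs_nonneg x) hxabs
  have hp0 : 0 ≤ |x|^(2*N) := by positivity
  rw [hp]
  have hFx := h0 x hx
  by_cases hc : |x| ≤ 1 - d
  · have : |x|^(2*N) ≤ e/(M+1) := by
      calc |x|^(2*N) ≤ |x|^N := pow_le_pow_of_le_one (abs_nonneg x) hxabs (by omega)
        _ ≤ (1-d)^N := by gcongr
        _ ≤ _ := hN.le
    have h3 : |G x| * |x|^(2*N) ≤ M * (e/(M+1)) := by gcongr
    have h4 : M * (e/(M+1)) ≤ e := by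
      rw [mul_div_assoc', div_le_iff₀ (by positivity)]; nlinarith
    linarith
  · push Not at hc
    have h5 : -(2*e) < F x - |G x| := by
      rcases le_total 0 x with h | h
      · rw [abs_of_nonneg h] at hc
        apply k1
        rw [Real.dist_eq, abs_lt]; constructor <;> linarith [hx.2]
      · rw [abs_of_nonpos h] at hc
        apply k2
        rw [Real.dist_eq, abs_lt]; constructor <;> linarith [hx.1]
    nlinarith

theorem exAngle (a b : ℝ) (h : a^2+b^2 = 1) : ∃ t, Real.cos t = a ∧ Real.sin t = b := by
  have hn : ‖(⟨a,b⟩:ℂ)‖ = 1 := by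
    rw [Complex.norm_def, Complex.normSq_mk, ← sq, ← sq, h, Real.sqrt_one]
  have h0 : (⟨a,b⟩:ℂ) ≠ 0 := by intro h; rw [h] at hn; simp at hn
  refine ⟨Complex.arg ⟨a,b⟩, ?_, ?_⟩
  · rw [Complex.cos_arg h0, hn]; simp
  · rw [Complex.sin_arg, hn]; simp

theorem scal2 (c a1 a2 a3 b12 b13 b23 : ℝ)
    (H1 : ∀ s1 s2 s3 : ℝ, (s1 = 1 ∨ s1 = -1) → (s2 = 1 ∨ s2 = -1) → (s3 = 1 ∨ s3 = -1) →
      0 ≤ c + a1*s1 + a2*s2 + a3*s3 + b12*(s1*s2) + b13*(s1*s3) + b23*(s2*s3))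
    (H2 : ∀ t1 t2 t3 : ℝ, 0 ≤ c + b12 * Real.cos (t1-t2) + b13 * Real.cos (t1-t3) + b23 * Real.cos (t2-t3))
    (x : ℝ) (hx : x ∈ Icc (-1:ℝ) 1) :
    max |a3| (√(b13^2+b23^2+2*b13*b23*x)) ≤ c + b12*x := by
  have hA : |a3| ≤ c + b12*x := by
    have p1 : 0 ≤ (1+x)/4 := by linarith [hx.1]
    have p2 : 0 ≤ (1-x)/4 := by linarith [hx.2]
    rw [abs_le]
    have q := fun s1 s2 s3 h1 h2 h3 => mul_nonneg p1 (H1 s1 s2 s3 h1 h2 h3)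
    have q' := fun s1 s2 s3 h1 h2 h3 => mul_nonneg p2 (H1 s1 s2 s3 h1 h2 h3)
    constructor
    · have z1 := q 1 1 1 (by simp) (by simp) (by simp)
      have z2 := q (-1) (-1) 1 (by simp) (by simp) (by simp)
      have z3 := q' 1 (-1) 1 (by simp) (by simp) (by simp)
      have z4 := q' (-1) 1 1 (by simp) (by simp) (by simp)
      linarith
    · have z1 := q 1 1 (-1) (by simp) (by simp) (by simp)
      have z2 := q (-1) (-1) (-1) (by simp) (by simp) (by simp)
      have z3 := q' 1 (-1) (-1) (by simp) (by simp) (by simp)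
      have z4 := q' (-1) 1 (-1) (by simp) (by simp) (by simp)
      linarith
  refine max_le hA ?_
  set R := b13^2+b23^2+2*b13*b23*x with hR
  set r := √R with hr
  rcases (Real.sqrt_nonneg R).eq_or_lt with h | h
  · rw [hr, ← h]; exact (abs_nonneg _).trans hA
  · have hR0 : 0 < R := Real.sqrt_pos.1 h
    have hrr : r*r = R := Real.mul_self_sqrt hR0.le
    have hr0 : r ≠ 0 := h.ne'
    set y := √(1-x^2) with hy
    have hyy : y^2 = 1-x^2 := Real.sq_sqrt (by nlinarith [hx.1, hx.2])
    obtain ⟨t2, hc2, hs2⟩ := exAngle x y (by rw [hyy]; ring)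
    obtain ⟨t3, hc3, hs3⟩ := exAngle (-(b13+b23*x)/r) (-(b23*y)/r) (by
      field_simp
      rw [pow_two r, hrr, hR]; linear_combination b23^2*hyy)
    have := H2 0 t2 t3
    rw [zero_sub, zero_sub, Real.cos_neg, Real.cos_neg, Real.cos_sub, hc2, hs2, hc3, hs3] at this
    have e : b13 * (-(b13+b23*x)/r) + b23 * (x * (-(b13+b23*x)/r) + y * (-(b23*y)/r)) = -r := by
      field_simp
      rw [pow_two r, hrr, hR]; linear_combination -b23^2*hyy
    linarith

section
variable {A : Type} [CStarAlgebra A]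

theorem commX (u v : A) (hu : u*u=1) : Commute ((1/2:ℝ)•(u*v+v*u)) u := by
  have : (u*v+v*u)*u = u*(u*v+v*u) := by
    rw [add_mul, mul_add, ← mul_assoc u u v, hu, mul_assoc v u u, hu, mul_assoc]; simp [add_comm]
  rw [Commute, SemiconjBy, smul_mul_assoc, mul_smul_comm, this]

theorem cfcSqrt (X : A) 
    (hs : spectrum ℝ X ⊆ Icc (-1) 1) (f : ℝ → ℝ) (hf : Continuous f)
    (h0 : ∀ x ∈ Icc (-1:ℝ) 1, 0 ≤ f x) :
    ∃ s : A, s = cfc (fun x => √(f x)) X ∧ star s = s ∧ s * s = cfc f X := by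
  refine ⟨_, rfl, cfc_predicate (fun x => √(f x)) X, ?_⟩
  rw [← cfc_mul (fun x => √(f x)) (fun x => √(f x)) X (by fun_prop) (by fun_prop)]
  apply cfc_congr
  intro x hx
  exact Real.mul_self_sqrt (h0 x (hs hx))

theorem specX [Nontrivial A] (u v : A) (hu : star u = u) (hv : star v = v) (hu2 : u*u=1) (hv2 : v*v=1) :
    spectrum ℝ ((1/2:ℝ)•(u*v+v*u)) ⊆ Icc (-1) 1 := by
  have nu : ‖u‖ = 1 := CStarRing.norm_of_mem_unitary (Unitary.mem_iff.2 ⟨by rw [hu, hu2], by rw [hu, hu2]⟩)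
  have nv : ‖v‖ = 1 := CStarRing.norm_of_mem_unitary (Unitary.mem_iff.2 ⟨by rw [hv, hv2], by rw [hv, hv2]⟩)
  intro k hk
  have h1 := spectrum.norm_le_norm_mul_of_mem hk
  rw [CStarRing.norm_one, mul_one, norm_smul] at h1
  have h2 : ‖u*v+v*u‖ ≤ 2 := by
    calc _ ≤ ‖u*v‖+‖v*u‖ := norm_add_le _ _
      _ ≤ ‖u‖*‖v‖+‖v‖*‖u‖ := add_le_add (norm_mul_le _ _) (norm_mul_le _ _)
      _ = 2 := by rw [nu, nv]; norm_num
  refine abs_le.1 ?_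
  rw [← Real.norm_eq_abs]
  refine h1.trans ?_
  norm_num
  linarith

theorem phiProj (φ : A →ₗ[ℝ] ℝ) (hpos : ∀ a, 0 ≤ φ (star a * a)) (htr : ∀ a b, φ (a*b) = φ (b*a))
    (w : A) (hw : star w = w) (hw2 : w*w=1) (z : A) : 0 ≤ φ ((1+w)*(star z * z)) := by
  have h := hpos (z * (1+w))
  have e : φ (star (z*(1+w)) * (z*(1+w))) = 2 * φ ((1+w)*(star z * z)) := by
    rw [star_mul, star_add, star_one, hw, mul_assoc, htr, ← smul_eq_mul (2:ℝ), ← map_smul]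
    rw [show star z * (z * (1+w)) * (1+w) = (star z * z) * ((1+w)*(1+w)) by noncomm_ring]
    rw [show (1+w)*(1+w) = (2:ℝ)•(1+w) by
      rw [mul_add, add_mul, add_mul, hw2]; simp only [one_mul, mul_one, two_smul]; abel]
    rw [htr, smul_mul_assoc]
  linarith

-- main positivity
theorem phiPos2 (φ : A →ₗ[ℝ] ℝ) (hpos : ∀ a, 0 ≤ φ (star a * a)) (htr : ∀ a b, φ (a*b) = φ (b*a))
    (w : A) (hw : star w = w) (hw2 : w*w=1) (X : A) (hX : IsSelfAdjoint X) 
    (hs : spectrum ℝ X ⊆ Icc (-1) 1) (V : A) (hV : star V = V) (hXV : Commute X V)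
    (R f n : ℝ → ℝ) (hR : Continuous R) (hf : Continuous f) (hn : Continuous n) (hVR : V*V = cfc R X)
    (hf0 : ∀ x ∈ Icc (-1:ℝ) 1, 0 ≤ f x) (hnR : ∀ x ∈ Icc (-1:ℝ) 1, n x * n x * R x ≤ 1) :
    0 ≤ φ ((1+w) * (cfc f X * (1 + cfc n X * V))) := by
  obtain ⟨s, hs1, hs2, hs3⟩ := cfcSqrt X hs f hf hf0
  obtain ⟨t, ht1, ht2, ht3⟩ := cfcSqrt X hs (fun x => f x * (1 - n x * n x * R x)) (by fun_prop)
    (fun x hx => mul_nonneg (hf0 x hx) (by linarith [hnR x hx]))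
  have hnV : Commute (cfc n X) V := hXV.cfc_real n
  have hsV : Commute s V := hs1 ▸ hXV.cfc_real _
  have hsn : Commute s (cfc n X) := hs1 ▸ cfc_commute_cfc _ _ _
  have hnsa : star (cfc n X) = cfc n X := cfc_predicate n X
  set N := cfc n X with hN
  have hsNV : Commute s (1 + N*V) := (Commute.one_right s).add_right (hsn.mul_right hsV)
  have e1 : star (s*(1+N*V)) * (s*(1+N*V)) = cfc f X * ((1+N*V)*(1+N*V)) := by
    rw [star_mul, star_add, star_mul, star_one, hs2, hV, hnsa, ← hnV.eq, hsNV.eq, ← hs3]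
    rw [mul_assoc, ← mul_assoc s _ s, hsNV.eq, mul_assoc _ s s, ← mul_assoc]
    exact (((hsNV.mul_left hsNV).mul_right (hsNV.mul_left hsNV)).eq).symm
  have e2 : star t * t = cfc f X * (1 - (N*V)*(N*V)) := by
    rw [ht2, ht3, cfc_mul f _ X (by fun_prop) (by fun_prop)]
    congr 1
    rw [cfc_sub (fun _ => (1:ℝ)) (fun x => n x * n x * R x) X (by fun_prop) (by fun_prop), cfc_const _ _ hX, map_one,
      cfc_mul (fun x => n x * n x) R X (by fun_prop) (by fun_prop),
      cfc_mul n n X (by fun_prop) (by fun_prop), ← hVR, ← hN]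
    congr 1
    rw [mul_assoc, mul_assoc, ← mul_assoc V N V, ← hnV.eq, mul_assoc]
  have p1 := phiProj φ hpos htr w hw hw2 (s*(1+N*V))
  have p2 := phiProj φ hpos htr w hw hw2 t
  rw [e1] at p1; rw [e2] at p2
  have : (2:ℝ) * φ ((1+w) * (cfc f X * (1 + N * V))) =
     φ ((1+w) * (cfc f X * ((1+N*V)*(1+N*V)))) + φ ((1+w)*(cfc f X * (1 - (N*V)*(N*V)))) := by
    rw [← smul_eq_mul, ← map_smul, ← map_add, two_smul]
    congr 1
    noncomm_ring
  linarith

theorem phiSwap (φ : A →ₗ[ℝ] ℝ) (htr : ∀ a b, φ (a*b) = φ (b*a))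
    (u v : A) (hv2 : v*v=1) (X : A) (hX : IsSelfAdjoint X)
    (hXd : X = (1/2:ℝ)•(u*v+v*u)) 
    (f : ℝ → ℝ) (hf : Continuous f) :
    φ (cfc f X * u) = φ (cfc (fun x => f x * x) X * v) := by
  have hXv : Commute X v := by rw [hXd, add_comm]; exact commX v u hv2
  have hfv : Commute (cfc f X) v := hXv.cfc_real f
  rw [cfc_mul f (fun x => x) X (by fun_prop) (by fun_prop), cfc_id' ℝ X hX]
  have e : (2:ℝ) • (X * v) = u + v*u*v := by
    rw [hXd, smul_mul_assoc, smul_smul, add_mul, mul_assoc u v v, hv2]; norm_num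
  have h1 : φ (cfc f X * u) = φ (cfc f X * (v*u*v)) := by
    have : cfc f X * u = (cfc f X * u * v) * v := by rw [mul_assoc _ v v, hv2, mul_one]
    rw [this, htr]
    congr 1
    rw [← mul_assoc, ← mul_assoc, ← hfv.eq]; noncomm_ring
  have h2 : 2 * φ (cfc f X * X * v) = φ (cfc f X * u) + φ (cfc f X * (v*u*v)) := by
    rw [← map_add, ← mul_add, ← e, mul_smul_comm, map_smul, smul_eq_mul, mul_assoc]
  linarith

theorem phiBound (φ : A →ₗ[ℝ] ℝ) (hpos : ∀ a, 0 ≤ φ (star a * a)) (htr : ∀ a b, φ (a*b) = φ (b*a))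
    (u : A) (hu : star u = u) (hu2 : u*u=1) (X : A) 
    (hs : spectrum ℝ X ⊆ Icc (-1) 1) (G : ℝ → ℝ) (hG : Continuous G) :
    -φ (cfc (fun x => |G x|) X) ≤ φ (cfc G X * u) := by
  obtain ⟨s, -, hs2, hs3⟩ := cfcSqrt X hs (fun x => |G x| + G x) (by fun_prop)
    (fun x _ => by linarith [neg_abs_le (G x)])
  obtain ⟨t, -, ht2, ht3⟩ := cfcSqrt X hs (fun x => |G x| - G x) (by fun_prop)
    (fun x _ => by linarith [le_abs_self (G x)])
  have p1 := phiProj φ hpos htr u hu hu2 s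
  have p2 := phiProj φ hpos htr (-u) (by rw [star_neg, hu]) (by rw [neg_mul_neg, hu2]) t
  rw [hs2, hs3, cfc_add X (fun x => |G x|) G (by fun_prop) (by fun_prop), htr] at p1
  rw [ht2, ht3, cfc_sub (fun x => |G x|) G X (by fun_prop) (by fun_prop), htr] at p2
  have : φ ((cfc (fun x => |G x|) X + cfc G X) * (1+u)) + φ ((cfc (fun x => |G x|) X - cfc G X) * (1 + -u))
      = 2 * (φ (cfc (fun x => |G x|) X) + φ (cfc G X * u)) := by
    rw [← map_add, ← map_add, ← smul_eq_mul (2:ℝ), ← map_smul, two_smul]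
    congr 1; noncomm_ring
  linarith
theorem phiPow (φ : A →ₗ[ℝ] ℝ) (htr : ∀ a b, φ (a*b) = φ (b*a))
    (u v : A) (hu2 : u*u=1) (hv2 : v*v=1) (X : A) (hX : IsSelfAdjoint X)
    (hXd : X = (1/2:ℝ)•(u*v+v*u))
    (f : ℝ → ℝ) (hf : Continuous f) (N : ℕ) :
    φ (cfc f X * u) = φ (cfc (fun x => f x * x^(2*N)) X * u) := by
  induction N with
  | zero => simp
  | succ N ih =>
    rw [ih, phiSwap φ htr u v hv2 X hX hXd _ (by fun_prop),
      phiSwap φ htr v u hu2 X hX (by rw [hXd, add_comm]) _ (by fun_prop)]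
    congr 3
    funext x
    ring

theorem mainL [Nontrivial A] (φ : A →ₗ[ℝ] ℝ) (hpos : ∀ a, 0 ≤ φ (star a * a))
    (htr : ∀ a b, φ (a*b) = φ (b*a)) (h1 : φ 1 = 1) (u v w : A)
    (hu : star u = u) (hv : star v = v) (hw : star w = w)
    (hu2 : u*u=1) (hv2 : v*v=1) (hw2 : w*w=1)
    (c a1 a2 a3 b12 b13 b23 : ℝ)
    (H1 : ∀ s1 s2 s3 : ℝ, (s1 = 1 ∨ s1 = -1) → (s2 = 1 ∨ s2 = -1) → (s3 = 1 ∨ s3 = -1) →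
      0 ≤ c + a1*s1 + a2*s2 + a3*s3 + b12*(s1*s2) + b13*(s1*s3) + b23*(s2*s3))
    (H2 : ∀ t1 t2 t3 : ℝ,
      0 ≤ c + b12 * Real.cos (t1-t2) + b13 * Real.cos (t1-t3) + b23 * Real.cos (t2-t3)) :
    0 ≤ c + a1 * φ u + a2 * φ v + a3 * φ w + b12 * φ (u*v) + b13 * φ (u*w) + b23 * φ (v*w) := by
  suffices h : ∀ e : ℝ, 0 < e → -(4*e) ≤
      c + a1 * φ u + a2 * φ v + a3 * φ w + b12 * φ (u*v) + b13 * φ (u*w) + b23 * φ (v*w) by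
    refine le_of_forall_pos_le_add fun e he => ?_
    have := h (e/4) (by positivity)
    linarith
  intro e he
  obtain ⟨X, hXd⟩ : ∃ X : A, X = (1/2:ℝ)•(u*v+v*u) := ⟨_, rfl⟩
  have hX : IsSelfAdjoint X := by
    rw [hXd, IsSelfAdjoint, star_smul, star_add, star_mul, star_mul, hu, hv, add_comm]; simp
  have hs : spectrum ℝ X ⊆ Icc (-1) 1 := hXd ▸ specX u v hu hv hu2 hv2
  have hXu : Commute X u := by rw [hXd]; exact commX u v hu2
  have hXv : Commute X v := by rw [hXd, add_comm]; exact commX v u hv2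
  obtain ⟨V, hVd⟩ : ∃ V : A, V = b13 • u + b23 • v := ⟨_, rfl⟩
  have hV : star V = V := by rw [hVd, star_add, star_smul, star_smul, hu, hv]; simp
  have hXV : Commute X V := by
    rw [hVd]; exact (hXu.smul_right b13).add_right (hXv.smul_right b23)
  set R : ℝ → ℝ := fun x => b13^2+b23^2+2*b13*b23*x with hRd
  have hR : Continuous R := by fun_prop
  have hVR : V*V = cfc R X := by
    rw [hRd, cfc_add X (fun _ => b13^2+b23^2) (fun x => 2*b13*b23*x) (by fun_prop) (by fun_prop),
      cfc_const _ X hX, cfc_const_mul (2*b13*b23) (fun x => x) X (by fun_prop), cfc_id' ℝ X hX, hXd, hVd,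
      Algebra.algebraMap_eq_smul_one]
    simp only [mul_add, add_mul, smul_mul_assoc, mul_smul_comm, hu2, hv2, smul_add, smul_smul]
    module
  set m : ℝ → ℝ := fun x => max |a3| (√(R x)) + e with hmd
  have hm : Continuous m := by fun_prop
  have hma : ∀ x, |a3| ≤ m x := fun x => by
    have := le_max_left |a3| (√(R x)); simp only [hmd]; linarith
  have hmr : ∀ x, √(R x) ≤ m x := fun x => by
    have := le_max_right |a3| (√(R x)); simp only [hmd]; linarith
  have hm0 : ∀ x, 0 < m x := fun x => by simp only [hmd]; positivity
  set n : ℝ → ℝ := fun x => (m x)⁻¹ with hnd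
  have hn : Continuous n := hm.inv₀ fun x => (hm0 x).ne'
  have hnR : ∀ x ∈ Icc (-1:ℝ) 1, n x * n x * R x ≤ 1 := by
    intro x hx
    have hRm : R x ≤ m x * m x := by
      rcases le_total 0 (R x) with h | h
      · rw [← Real.mul_self_sqrt h]
        exact mul_self_le_mul_self (Real.sqrt_nonneg _) (hmr x)
      · exact h.trans (mul_self_nonneg _)
    calc n x * n x * R x ≤ n x * n x * (m x * m x) :=
          mul_le_mul_of_nonneg_left hRm (mul_self_nonneg _)
      _ = 1 := by have := (hm0 x).ne'; simp only [hnd]; field_simp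
  have p1 := phiPos2 φ hpos htr w hw hw2 X hX hs V hV hXV R (fun x => m x + a3) n hR (by fun_prop) hn hVR
    (fun x _ => by have := neg_abs_le a3; have := hma x; linarith) hnR
  have p2 := phiPos2 φ hpos htr (-w) (by rw [star_neg, hw]) (by rw [neg_mul_neg, hw2]) X hX hs V hV hXV R
    (fun x => m x - a3) (fun x => - n x) hR (by fun_prop) (by fun_prop) hVR
    (fun x _ => by have := le_abs_self a3; have := hma x; linarith)
    (fun x hx => by rw [neg_mul_neg]; exact hnR x hx)
  rw [cfc_add X m (fun _ => a3) (by fun_prop) (by fun_prop), cfc_const _ X hX,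
    Algebra.algebraMap_eq_smul_one] at p1
  rw [cfc_sub m (fun _ => a3) X (by fun_prop) (by fun_prop), cfc_const _ X hX,
    Algebra.algebraMap_eq_smul_one, cfc_neg n X] at p2
  have hMN : cfc m X * cfc n X = 1 := by
    rw [← cfc_mul m n X (by fun_prop) (by fun_prop), ← cfc_one ℝ X hX]
    apply cfc_congr
    intro x _
    exact mul_inv_cancel₀ (hm0 x).ne'
  obtain ⟨M, hM⟩ : ∃ M, M = cfc m X := ⟨_, rfl⟩
  obtain ⟨N, hN⟩ : ∃ N, N = cfc n X := ⟨_, rfl⟩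
  rw [← hM, ← hN] at p1 p2 hMN
  have ePos : (M + a3 • (1:A)) * (1 + N*V) = M + V + a3 • 1 + a3 • (N*V) := by
    rw [add_mul, mul_add, ← mul_assoc, hMN]
    simp only [mul_one, one_mul, smul_mul_assoc, smul_add]
    abel
  have eNeg : (M - a3 • (1:A)) * (1 + -N*V) = M - V - a3 • 1 + a3 • (N*V) := by
    rw [sub_mul, mul_add, ← mul_assoc, mul_neg, hMN]
    simp only [mul_one, one_mul, smul_mul_assoc, smul_add, neg_mul, smul_neg]
    abel
  rw [ePos] at p1
  rw [eNeg] at p2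
  have p3 : 0 ≤ φ M + a3 * φ (N*V) + a3 * φ w + φ (w*V) := by
    simp only [add_mul, mul_add, mul_sub, one_mul, neg_mul, map_add, map_sub, map_neg, mul_smul_comm,
      map_smul, smul_eq_mul, mul_one] at p1 p2
    linarith
  have eNV : φ (N*V) = b13 * φ (N*u) + b23 * φ (N*v) := by
    rw [hVd]; simp [mul_add]
  have ewV : φ (w*V) = b13 * φ (u*w) + b23 * φ (v*w) := by
    rw [hVd, htr u w, htr v w]; simp [mul_add]
  have eX : φ X = φ (u*v) := by
    rw [hXd, map_smul, map_add, htr v u, smul_eq_mul]; ring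
  set F : ℝ → ℝ := fun x => c + b12*x - m x with hFd
  set G1 : ℝ → ℝ := fun x => a1 - (a3*b13) * n x with hG1d
  set G2 : ℝ → ℝ := fun x => a2 - (a3*b23) * n x with hG2d
  set G : ℝ → ℝ := fun x => G1 x + G2 x * x with hGd
  have hF : Continuous F := by fun_prop
  have hG1 : Continuous G1 := by fun_prop
  have hG2 : Continuous G2 := by fun_prop
  have hG : Continuous G := by fun_prop
  have eF : φ (cfc F X) = c + b12 * φ (u*v) - φ M := by
    rw [hFd, cfc_sub (fun x => c + b12*x) m X (by fun_prop) (by fun_prop),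
      cfc_add X (fun _ => c) (fun x => b12*x) (by fun_prop) (by fun_prop), cfc_const _ X hX,
      cfc_const_mul b12 (fun x => x) X (by fun_prop), cfc_id' ℝ X hX,
      Algebra.algebraMap_eq_smul_one, ← hM, map_sub, map_add, map_smul, map_smul, h1, eX]
    simp
  have eG1 : φ (cfc G1 X * u) = a1 * φ u - a3 * b13 * φ (N*u) := by
    rw [hG1d, cfc_sub (fun _ => a1) (fun x => (a3*b13) * n x) X (by fun_prop) (by fun_prop),
      cfc_const _ X hX, cfc_const_mul (a3*b13) n X (by fun_prop), Algebra.algebraMap_eq_smul_one, ← hN]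
    simp [sub_mul]
  have eG2 : φ (cfc G2 X * v) = a2 * φ v - a3 * b23 * φ (N*v) := by
    rw [hG2d, cfc_sub (fun _ => a2) (fun x => (a3*b23) * n x) X (by fun_prop) (by fun_prop),
      cfc_const _ X hX, cfc_const_mul (a3*b23) n X (by fun_prop), Algebra.algebraMap_eq_smul_one, ← hN]
    simp [sub_mul]
  have eG : φ (cfc G X * u) = φ (cfc G1 X * u) + φ (cfc G2 X * v) := by
    rw [phiSwap φ htr v u hu2 X hX (by rw [hXd, add_comm]) G2 hG2, ← map_add, ← add_mul,
      ← cfc_add X G1 (fun x => G2 x * x) (by fun_prop) (by fun_prop)]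
  have hF0 : ∀ x ∈ Icc (-1:ℝ) 1, -(2*e) ≤ F x := by
    intro x hx
    have := scal2 c a1 a2 a3 b12 b13 b23 H1 H2 x hx
    simp only [hFd, hmd, hRd]
    linarith
  have hE1 : |G 1| - 2*e ≤ F 1 := by
    have hm1 : m 1 = max |a3| |b13+b23| + e := by
      simp only [hmd, hRd]
      rw [show b13^2+b23^2+2*b13*b23*1 = (b13+b23)^2 by ring, Real.sqrt_sq_eq_abs]
    have q1 := scal1 a3 (b13+b23) e (m 1) he hm1
    have q2 := scal1 a3 (-(b13+b23)) e (m 1) he (by rw [abs_neg]; exact hm1)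
    have k1 : |a3 + (b13+b23)| ≤ c + a1 + a2 + b12 := by
      rw [abs_le]
      have z1 := H1 1 1 1 (by simp) (by simp) (by simp)
      have z2 := H1 1 1 (-1) (by simp) (by simp) (by simp)
      constructor <;> linarith
    have k2 : |a3 + -(b13+b23)| ≤ c - a1 - a2 + b12 := by
      rw [abs_le]
      have z1 := H1 (-1) (-1) 1 (by simp) (by simp) (by simp)
      have z2 := H1 (-1) (-1) (-1) (by simp) (by simp) (by simp)
      constructor <;> linarith
    have : |G 1| ≤ F 1 + 2*e := by
      simp only [hGd, hG1d, hG2d, hFd, hnd]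
      rw [div_eq_mul_inv] at q1 q2
      rw [abs_le]
      constructor <;> linarith
    linarith
  have hE2 : |G (-1)| - 2*e ≤ F (-1) := by
    have hm1 : m (-1) = max |a3| |b13-b23| + e := by
      simp only [hmd, hRd]
      rw [show b13^2+b23^2+2*b13*b23*(-1) = (b13-b23)^2 by ring, Real.sqrt_sq_eq_abs]
    have q1 := scal1 a3 (b13-b23) e (m (-1)) he hm1
    have q2 := scal1 a3 (-(b13-b23)) e (m (-1)) he (by rw [abs_neg]; exact hm1)
    have k1 : |a3 + (b13-b23)| ≤ c + a1 - a2 - b12 := by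
      rw [abs_le]
      have z1 := H1 1 (-1) 1 (by simp) (by simp) (by simp)
      have z2 := H1 1 (-1) (-1) (by simp) (by simp) (by simp)
      constructor <;> linarith
    have k2 : |a3 + -(b13-b23)| ≤ c - a1 + a2 - b12 := by
      rw [abs_le]
      have z1 := H1 (-1) 1 1 (by simp) (by simp) (by simp)
      have z2 := H1 (-1) 1 (-1) (by simp) (by simp) (by simp)
      constructor <;> linarith
    have : |G (-1)| ≤ F (-1) + 2*e := by
      simp only [hGd, hG1d, hG2d, hFd, hnd]
      rw [div_eq_mul_inv] at q1 q2
      rw [abs_le]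
      constructor <;> linarith
    linarith
  obtain ⟨K, hK⟩ := lemE F G hF hG (2*e) (by positivity) hF0 hE1 hE2
  have b1 := phiBound φ hpos htr u hu hu2 X hs (fun x => G x * x^(2*K)) (by fun_prop)
  rw [← phiPow φ htr u v hu2 hv2 X hX hXd G hG K] at b1
  obtain ⟨s, -, hs2, hs3⟩ := cfcSqrt X hs (fun x => F x - |G x * x^(2*K)| + 4*e) (by fun_prop)
    (fun x hx => by
      have := hK x hx
      rw [abs_mul, abs_of_nonneg (show 0 ≤ x^(2*K) by rw [pow_mul]; positivity)]
      linarith)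
  have b2 := hpos s
  rw [hs2, hs3, cfc_add X (fun x => F x - |G x * x^(2*K)|) (fun _ => 4*e) (by fun_prop) (by fun_prop),
    cfc_sub F (fun x => |G x * x^(2*K)|) X (by fun_prop) (by fun_prop), cfc_const _ X hX,
    Algebra.algebraMap_eq_smul_one, map_add, map_sub, map_smul, h1, smul_eq_mul, mul_one] at b2
  rw [eNV, ewV] at p3
  linarith
end

theorem dq_sub_dqc : Dq 3 ⊆ Dqc 3 := fun _ hw => ⟨hw.1, hw.2.choose.toProjRep, hw.2.choose_spec⟩

theorem dq_convex : Convex ℝ (Dq 3) := by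
  rintro w ⟨hw, r, hr⟩ w' ⟨hw', r', hr'⟩ a b ha hb hab
  refine ⟨?_, ?_⟩
  · rw [Matrix.IsSymm, Matrix.transpose_add, Matrix.transpose_smul, Matrix.transpose_smul, hw, hw']
  haveI := r.fd
  haveI := r'.fd
  have hab' : (a:ℂ) + b = 1 := by exact_mod_cast hab
  let R : ProjRep 3 :=
    { A := r.A × r'.A
      τ := (a:ℂ) • (r.τ ∘ₗ LinearMap.fst ℂ r.A r'.A) + (b:ℂ) • (r'.τ ∘ₗ LinearMap.snd ℂ r.A r'.A)
      P := fun i => (r.P i, r'.P i)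
      unit := by simp [r.unit, r'.unit, hab']
      pos := fun x => by
        have h1 := mul_nonneg (Complex.zero_le_real.2 ha) (r.pos x.1)
        have h2 := mul_nonneg (Complex.zero_le_real.2 hb) (r'.pos x.2)
        exact add_nonneg h1 h2
      tracial := fun x y => by simp [r.tracial x.1, r'.tracial x.2]
      proj_sa := fun i => Prod.ext (r.proj_sa i) (r'.proj_sa i)
      proj_idem := fun i => Prod.ext (r.proj_idem i) (r'.proj_idem i) }
  haveI : FiniteDimensional ℂ R.A := inferInstanceAs (FiniteDimensional ℂ (r.A × r'.A))
  refine ⟨⟨R⟩, fun i j => ?_⟩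
  simp [R, hr, hr']

/-- The commutative (deterministic) points. -/
noncomputable def detPt (s : Fin 3 → ℝ) : Matrix (Fin 3) (Fin 3) ℝ :=
  Matrix.of fun i j => (1 + s i) * (1 + s j) / 4

/-- The points coming from rank one real projections on a plane. -/
noncomputable def planePt (z : Fin 3 → ℂ) : Matrix (Fin 3) (Fin 3) ℝ :=
  Matrix.of fun i j => (1 + (z i).re * (z j).re + (z i).im * (z j).im) / 4

theorem detPt_mem (s : Fin 3 → ℝ) (hs : ∀ i, s i = 1 ∨ s i = -1) : detPt s ∈ Dq 3 := by
  refine ⟨by ext i j; simp [detPt, mul_comm], ?_⟩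
  let R : ProjRep 3 :=
    { A := ℂ
      τ := LinearMap.id
      P := fun i => (((1 + s i)/2 : ℝ) : ℂ)
      unit := rfl
      pos := fun x => star_mul_self_nonneg x
      tracial := fun x y => mul_comm x y
      proj_sa := fun i => Complex.conj_ofReal _
      proj_idem := fun i => by
        rw [← Complex.ofReal_mul]
        rcases hs i with h | h <;> rw [h] <;> norm_num }
  haveI : FiniteDimensional ℂ R.A := inferInstanceAs (FiniteDimensional ℂ ℂ)
  refine ⟨⟨R⟩, fun i j => ?_⟩
  simp [R, detPt]
  ring

section
open scoped Matrix.Norms.L2Operator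

/-- The real rank one projection attached to a unit complex number. -/
noncomputable def planeProj (z : ℂ) : Matrix (Fin 2) (Fin 2) ℂ :=
  !![(((1+z.re)/2 : ℝ):ℂ), ((z.im/2 : ℝ):ℂ); ((z.im/2 : ℝ):ℂ), (((1-z.re)/2 : ℝ):ℂ)]

theorem planePt_mem (z : Fin 3 → ℂ) (hz : ∀ i, (z i).re^2 + (z i).im^2 = 1) :
    planePt z ∈ Dq 3 := by
  refine ⟨by ext i j; simp [planePt, mul_comm], ?_⟩
  let R : ProjRep 3 :=
    { A := Matrix (Fin 2) (Fin 2) ℂ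
      complete := FiniteDimensional.complete ℂ _
      τ := (1/2:ℂ) • Matrix.traceLinearMap (Fin 2) ℂ ℂ
      P := fun i => planeProj (z i)
      unit := by simp
      pos := fun x => by
        have h := (Matrix.posSemidef_conjTranspose_mul_self x).trace_nonneg
        have h2 : (0:ℂ) ≤ 1/2 := by
          rw [show (1/2:ℂ) = ((1/2:ℝ):ℂ) by norm_num]; exact Complex.zero_le_real.2 (by norm_num)
        exact mul_nonneg h2 h
      tracial := fun x y => by simp [Matrix.trace_mul_comm x y]
      proj_sa := fun i => by
        ext a b
        fin_cases a <;> fin_cases b <;>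
          simp [planeProj, Matrix.star_apply]
      proj_idem := fun i => by
        have h : ((z i).re:ℂ)^2 + ((z i).im:ℂ)^2 = 1 := by exact_mod_cast hz i
        ext a b
        fin_cases a <;> fin_cases b <;>
          simp [planeProj, Matrix.mul_apply, Fin.sum_univ_two]
        · linear_combination (1/4) * h
        · ring
        · ring
        · linear_combination (1/4) * h }
  haveI : FiniteDimensional ℂ R.A := inferInstanceAs (FiniteDimensional ℂ (Matrix (Fin 2) (Fin 2) ℂ))
  refine ⟨⟨R⟩, fun i j => ?_⟩
  simp [R, planePt, planeProj, Matrix.trace, Matrix.mul_apply, Fin.sum_univ_two]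
  ring
end

/-- The compact set whose convex hull is the whole correlation set. -/
noncomputable def genSet : Set (Matrix (Fin 3) (Fin 3) ℝ) :=
  detPt '' (Set.univ.pi fun _ => ({1, -1} : Set ℝ)) ∪
    planePt '' (Set.univ.pi fun _ => Metric.sphere (0:ℂ) 1)

theorem genSet_compact : IsCompact genSet := by
  refine IsCompact.union ?_ ?_
  · refine (isCompact_univ_pi fun _ => (Set.toFinite _).isCompact).image ?_
    refine continuous_matrix fun i j => ?_
    simp only [detPt, Matrix.of_apply]
    fun_prop
  · refine (isCompact_univ_pi fun _ => isCompact_sphere _ _).image ?_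
    refine continuous_matrix fun i j => ?_
    simp only [planePt, Matrix.of_apply]
    have h1 : ∀ k : Fin 3, Continuous fun z : Fin 3 → ℂ => (z k).re :=
      fun k => Complex.continuous_re.comp (continuous_apply k)
    have h2 : ∀ k : Fin 3, Continuous fun z : Fin 3 → ℂ => (z k).im :=
      fun k => Complex.continuous_im.comp (continuous_apply k)
    exact ((continuous_const.add ((h1 i).mul (h1 j))).add ((h2 i).mul (h2 j))).div_const _

theorem hull_sub_dq : convexHull ℝ genSet ⊆ Dq 3 := by
  refine convexHull_min ?_ dq_convex
  rintro _ (⟨s, hs, rfl⟩ | ⟨z, hz, rfl⟩)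
  · exact detPt_mem s fun i => by simpa using hs i trivial
  · refine planePt_mem z fun i => ?_
    have h : ‖z i‖ = 1 := by simpa using hz i trivial
    have h2 := Complex.sq_norm (z i)
    rw [h, Complex.normSq_apply] at h2
    linarith

theorem dqc_sub_hull : Dqc 3 ⊆ convexHull ℝ genSet := by
  rintro w ⟨-, r, hr⟩
  by_contra hw
  haveI : LocallyConvexSpace ℝ (Matrix (Fin 3) (Fin 3) ℝ) :=
    inferInstanceAs (LocallyConvexSpace ℝ (Fin 3 → Fin 3 → ℝ))
  obtain ⟨f, q, hfw, hf⟩ := geometric_hahn_banach_point_closed (convex_convexHull ℝ genSet)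
    (compactHull genSet_compact).isClosed hw
  obtain ⟨k, hk⟩ : ∃ k : Fin 3 → Fin 3 → ℝ, ∀ M : Matrix (Fin 3) (Fin 3) ℝ,
      f M = ∑ i, ∑ j, M i j * k i j := by
    refine ⟨fun i j => f (Matrix.single i j 1), fun M => ?_⟩
    conv_lhs => rw [Matrix.matrix_eq_sum_single M]
    simp only [map_sum]
    refine Finset.sum_congr rfl fun i _ => Finset.sum_congr rfl fun j _ => ?_
    rw [← smul_eq_mul, ← map_smul, Matrix.smul_single, smul_eq_mul, mul_one]
  letI : CStarAlgebra r.A :=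
    { r.ring, r.starRing, r.cstar, r.alg, r.complete, r.smod with }
  let φ : r.A →ₗ[ℝ] ℝ := Complex.reLm ∘ₗ (r.τ.restrictScalars ℝ)
  have hφ : ∀ a, φ a = (r.τ a).re := fun a => rfl
  have h1 : φ 1 = 1 := by rw [hφ, r.unit]; simp
  have hpos : ∀ a, 0 ≤ φ (star a * a) := fun a => (Complex.le_def.1 (r.pos a)).1
  have htr : ∀ a b, φ (a*b) = φ (b*a) := fun a b => by rw [hφ, hφ, r.tracial]
  haveI : Nontrivial r.A := ⟨1, 0, fun h => by rw [h, map_zero] at h1; norm_num at h1⟩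
  have hwφ : ∀ i j, φ (r.P i * r.P j) = w i j := fun i j => by rw [hφ, ← hr]; simp
  let U : Fin 3 → r.A := fun i => (2:ℝ) • r.P i - 1
  have hUs : ∀ i, star (U i) = U i := fun i => by
    simp [U, r.proj_sa]
  have hU2 : ∀ i, U i * U i = 1 := fun i => by
    simp only [U, sub_mul, mul_sub, smul_mul_assoc, mul_smul_comm, r.proj_idem, mul_one, one_mul]
    module
  have hUφ : ∀ i, φ (U i) = 2 * w i i - 1 := fun i => by
    rw [← hwφ i i, r.proj_idem]; simp [U, h1]
  have hUUφ : ∀ i j, φ (U i * U j) = 4 * w i j - 2 * w i i - 2 * w j j + 1 := fun i j => by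
    rw [← hwφ i j, ← hwφ i i, ← hwφ j j, r.proj_idem, r.proj_idem]
    simp only [U, sub_mul, mul_sub, smul_mul_assoc, mul_smul_comm, mul_one, one_mul, map_sub, map_smul,
      smul_eq_mul, h1]
    ring
  have key := mainL φ hpos htr h1 (U 0) (U 1) (U 2) (hUs 0) (hUs 1) (hUs 2) (hU2 0) (hU2 1) (hU2 2)
    ((2*k 0 0 + 2*k 1 1 + 2*k 2 2 + k 0 1 + k 1 0 + k 0 2 + k 2 0 + k 1 2 + k 2 1)/4 - q)
    ((2*k 0 0 + k 0 1 + k 1 0 + k 0 2 + k 2 0)/4)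
    ((2*k 1 1 + k 0 1 + k 1 0 + k 1 2 + k 2 1)/4)
    ((2*k 2 2 + k 0 2 + k 2 0 + k 1 2 + k 2 1)/4)
    ((k 0 1 + k 1 0)/4) ((k 0 2 + k 2 0)/4) ((k 1 2 + k 2 1)/4)
    (by
      intro s1 s2 s3 e1 e2 e3
      have h := hf (detPt ![s1, s2, s3]) (subset_convexHull ℝ _ (Or.inl ⟨_, by
        intro i _
        fin_cases i <;> simpa, rfl⟩))
      rw [hk] at h
      simp only [Fin.sum_univ_three, detPt, Matrix.of_apply, Matrix.cons_val] at h
      rcases e1 with rfl | rfl <;> rcases e2 with rfl | rfl <;> rcases e3 with rfl | rfl <;> linarith)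
    (by
      intro t1 t2 t3
      have h := hf (planePt ![⟨Real.cos t1, Real.sin t1⟩, ⟨Real.cos t2, Real.sin t2⟩,
          ⟨Real.cos t3, Real.sin t3⟩]) (subset_convexHull ℝ _ (Or.inr ⟨_, by
        intro i _
        fin_cases i <;> simp [Complex.norm_def, Complex.normSq_mk, ← sq], rfl⟩))
      rw [hk] at h
      simp only [Fin.sum_univ_three, planePt, Matrix.of_apply, Matrix.cons_val] at h
      rw [Real.cos_sub, Real.cos_sub, Real.cos_sub]
      have g1 := congrArg (fun y => k 0 0 * y) (Real.cos_sq_add_sin_sq t1)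
      have g2 := congrArg (fun y => k 1 1 * y) (Real.cos_sq_add_sin_sq t2)
      have g3 := congrArg (fun y => k 2 2 * y) (Real.cos_sq_add_sin_sq t3)
      linarith)
  rw [hUφ, hUφ, hUφ, hUUφ, hUUφ, hUUφ] at key
  have hsym : ∀ i j, w i j = w j i := fun i j => by rw [← hwφ, ← hwφ, htr]
  rw [hk] at hfw
  simp only [Fin.sum_univ_three] at hfw
  rw [hsym 1 0, hsym 2 0, hsym 2 1] at hfw
  linarith
end helpers

/-- D_q(3) = D_qc(3); consequently D_q(3) is a closed subset of the
real 3×3 matrices. -/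
theorem stmt19 : Dq 3 = Dqc 3 ∧ IsClosed (Dq 3) := by
  have h2 := hull_sub_dq
  have h3 := dqc_sub_hull
  have h1 := dq_sub_dqc
  refine ⟨h1.antisymm (h3.trans h2), ?_⟩
  rw [(h1.trans h3).antisymm h2]
  exact (compactHull genSet_compact).isClosed
end
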